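/- arXiv:1403.4673 — 3 statements merged into one kernel-verified Lean document; each statement's English description precedes it below -/
import Mathlib

section
/- Let H be a finite dimensional Hopf algebra over k acting inner faithfully on a commutative domain A (as a left H-module algebra). Then the H-action on A extends to an H-action on the quotient field Q_A = A·S^{-1} of A (where S is the set of nonzero elements of A), and this extended action makes Q_A an inner faithful H-module field. -/
open TensorProduct

/-- A grouplike element of a Hopf algebra. -/
def IsGrouplike (k : Type) {H : Type} [CommSemiring k] [Semiring H] [HopfAlgebra k H]
    (g : H) : Prop :=
  g ≠ 0 ∧ Coalgebra.comul (R := k) g = g ⊗ₜ[k] g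

/-- A Hopf ideal of a Hopf algebra `H` over `k`: a two-sided ideal which is also a coideal
and is stable under the antipode. -/
structure HopfIdeal (k H : Type) [CommSemiring k] [Semiring H] [HopfAlgebra k H] where
  carrier : Submodule k H
  mul_mem_left : ∀ (a : H) {x : H}, x ∈ carrier → a * x ∈ carrier
  mul_mem_right : ∀ (a : H) {x : H}, x ∈ carrier → x * a ∈ carrier
  comul_mem : ∀ x ∈ carrier, Coalgebra.comul (R := k) x ∈
      (LinearMap.range (TensorProduct.map carrier.subtype (LinearMap.id (M := H))) ⊔
       LinearMap.range (TensorProduct.map (LinearMap.id (M := H)) carrier.subtype))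
  counit_eq_zero : ∀ x ∈ carrier, Coalgebra.counit (R := k) x = 0
  antipode_mem : ∀ x ∈ carrier, HopfAlgebra.antipode (R := k) x ∈ carrier

/-- A (left) action of a Hopf algebra `H` on an algebra `A`, making `A` an `H`-module algebra:
`h ⬝ (a b) = ∑ (h₁ ⬝ a) (h₂ ⬝ b)` and `h ⬝ 1 = ε(h) 1`. -/
structure HopfAction (k H A : Type) [CommSemiring k] [Semiring H] [HopfAlgebra k H]
    [Semiring A] [Algebra k A] where
  act : H →ₐ[k] Module.End k A
  act_mul : ∀ (h : H) (a b : A),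
    act h (a * b) = LinearMap.mul' k A
      (TensorProduct.map ((act.toLinearMap : H →ₗ[k] A →ₗ[k] A).flip a)
        ((act.toLinearMap : H →ₗ[k] A →ₗ[k] A).flip b) (Coalgebra.comul (R := k) h))
  act_one : ∀ h : H, act h (1 : A) = Coalgebra.counit (R := k) h • (1 : A)

/-- A module over a Hopf algebra (given by its structure map `ρ`) is inner faithful if no
nonzero Hopf ideal annihilates it. -/
def InnerFaithful (k : Type) {H M : Type} [CommSemiring k] [Semiring H] [HopfAlgebra k H]
    [AddCommMonoid M] [Module k M] (ρ : H →ₗ[k] Module.End k M) : Prop :=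
  ∀ I : HopfIdeal k H, (∀ x ∈ I.carrier, ρ x = 0) → I.carrier = ⊥

/-- A witness that the Hopf algebra `H` is Galois-theoretical: a field `L ⊇ k` together with an
inner faithful `H`-module algebra structure on `L`. -/
structure GTWitness (k H : Type) [Field k] [Semiring H] [HopfAlgebra k H] : Type 1 where
  L : Type
  [fieldL : Field L]
  [algL : Algebra k L]
  action : HopfAction k H L
  faithful : InnerFaithful k action.act.toLinearMap

/-- A Hopf algebra is Galois-theoretical if it acts inner faithfully and `k`-linearly on a field
containing `k`. -/
def GaloisTheoretical (k H : Type) [Field k] [Semiring H] [HopfAlgebra k H] : Prop :=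
  Nonempty (GTWitness k H)

/-- The set of invariants of a Hopf algebra action. -/
def HopfAction.invariants {k H A : Type} [CommSemiring k] [Semiring H] [HopfAlgebra k H]
    [Semiring A] [Algebra k A] (ha : HopfAction k H A) : Set A :=
  {a : A | ∀ h : H, ha.act h a = Coalgebra.counit (R := k) h • a}

/-- A subcoalgebra: a subspace `V` with `Δ(V) ⊆ V ⊗ V`. -/
def IsSubcoalgebra (k : Type) {H : Type} [CommSemiring k] [Semiring H] [HopfAlgebra k H]
    (V : Submodule k H) : Prop :=
  ∀ x ∈ V, Coalgebra.comul (R := k) x ∈ LinearMap.range (TensorProduct.map V.subtype V.subtype)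

/-- A simple subcoalgebra: a nonzero subcoalgebra with no nonzero proper subcoalgebras. -/
def IsSimpleSubcoalgebra (k : Type) {H : Type} [CommSemiring k] [Semiring H] [HopfAlgebra k H]
    (V : Submodule k H) : Prop :=
  IsSubcoalgebra k V ∧ V ≠ ⊥ ∧
    ∀ W : Submodule k H, IsSubcoalgebra k W → W ≤ V → W = ⊥ ∨ W = V

/-- The coradical of a Hopf algebra: the sum of all its simple subcoalgebras. -/
def coradical (k H : Type) [CommSemiring k] [Semiring H] [HopfAlgebra k H] : Submodule k H :=
  sSup {V : Submodule k H | IsSimpleSubcoalgebra k V}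

/-- A Hopf algebra is pointed iff its coradical is spanned by the grouplike elements. -/
def IsPointedHopf (k H : Type) [CommSemiring k] [Semiring H] [HopfAlgebra k H] : Prop :=
  coradical k H = Submodule.span k {g : H | IsGrouplike k g}


namespace HopfExt
open WithConv Coalgebra

theorem extend_exists {A Q R : Type} [CommRing A] [IsDomain A] [Field Q] [Algebra A Q]
    [IsFractionRing A Q] [Ring R] (f : A →+* R) (hf : ∀ s : A, s ≠ 0 → IsUnit (f s)) :
    ∃ F : Q →+* R, ∀ a, F (algebraMap A Q a) = f a := by
  let S := nonZeroDivisors A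
  have hS : ∀ s : S, IsUnit ((f.toMonoidHom.comp S.subtype) s) := fun s =>
    hf s (nonZeroDivisors.ne_zero s.2)
  let fS : S →* Rˣ := IsUnit.liftRight (f.toMonoidHom.comp S.subtype) hS
  have hfS : ∀ s : S, f s = fS s := fun s => (IsUnit.coe_liftRight _ hS s).symm
  let U : Localization S →+* R := OreLocalization.universalHom f fS hfS
  let e : Q ≃ₐ[A] Localization S := IsLocalization.algEquiv S Q (Localization S)
  refine ⟨U.comp (e : Q →+* Localization S), fun a => ?_⟩
  have : e (algebraMap A Q a) = algebraMap A _ a := e.commutes a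
  simp only [RingHom.comp_apply]
  show U (e (algebraMap A Q a)) = _
  rw [this]
  exact OreLocalization.universalHom_commutes f fS hfS

theorem ext_frac {A Q R : Type} [CommRing A] [IsDomain A] [Field Q] [Algebra A Q]
    [IsFractionRing A Q] [Ring R] (F G : Q →+* R)
    (h : ∀ a : A, F (algebraMap A Q a) = G (algebraMap A Q a)) : F = G := by
  ext q
  obtain ⟨a, s, hs, rfl⟩ := IsFractionRing.div_surjective (A := A) q
  have hs0 : algebraMap A Q s ≠ 0 := by
    simpa using nonZeroDivisors.ne_zero hs
  have hu : IsUnit (F (algebraMap A Q s)) := (IsUnit.mk0 _ hs0).map F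
  apply hu.mul_left_cancel
  rw [← map_mul, mul_div_cancel₀ _ hs0, h s, ← map_mul, mul_div_cancel₀ _ hs0, h a]

variable {k H A B : Type} [Field k] [Ring H] [HopfAlgebra k H]

/-- Postcomposition. -/
def convMap [Ring A] [Algebra k A] [Ring B] [Algebra k B] (j : A →ₐ[k] B) :
    WithConv (H →ₗ[k] A) →+* WithConv (H →ₗ[k] B) where
  toFun f := toConv (j.toLinearMap ∘ₗ f.ofConv)
  map_one' := by ext; simp
  map_zero' := by ext; simp
  map_add' f g := by ext; simp
  map_mul' f g := by
    rw [LinearMap.algHom_comp_convMul_distrib]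

theorem convMap_apply [Ring A] [Algebra k A] [Ring B] [Algebra k B] (j : A →ₐ[k] B)
    (f : WithConv (H →ₗ[k] A)) (h : H) : convMap j f h = j (f h) := rfl

/-- The coaction. -/
def coact [CommRing A] [Algebra k A] (ha : HopfAction k H A) :
    A →+* WithConv (H →ₗ[k] A) where
  toFun a := toConv ((ha.act.toLinearMap : H →ₗ[k] A →ₗ[k] A).flip a)
  map_one' := by
    ext h
    simp [ha.act_one, Algebra.algebraMap_eq_smul_one]
  map_zero' := by ext; simp
  map_add' f g := by ext; simp
  map_mul' a b := by
    ext h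
    simpa using ha.act_mul h a b

theorem coact_apply [CommRing A] [Algebra k A] (ha : HopfAction k H A) (a : A) (h : H) :
    coact ha a h = ha.act h a := rfl

theorem coact_inj [CommRing A] [IsDomain A] [Algebra k A] (ha : HopfAction k H A) (s : A)
    (hs : s ≠ 0) (G : WithConv (H →ₗ[k] A)) (hG : coact ha s * G = 0) : G = 0 := by
  let l : A →ₐ[k] Module.End k A := Algebra.lmul k A
  let α : WithConv (H →ₗ[k] Module.End k A) := convMap ha.act (toConv LinearMap.id)
  let β : WithConv (H →ₗ[k] Module.End k A) := convMap ha.act (toConv (HopfAlgebra.antipode k))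
  have hab : α * β = 1 := by
    rw [← map_mul, LinearMap.id_mul_antipode, map_one]
  have hba : β * α = 1 := by
    rw [← map_mul, LinearMap.antipode_mul_id, map_one]
  let c : WithConv (H →ₗ[k] Module.End k A) :=
    toConv ((LinearMap.toSpanSingleton k (Module.End k A) (l s)) ∘ₗ counit)
  have hc : ∀ (X : WithConv (H →ₗ[k] Module.End k A)) (h : H), (c * X) h = l s * X h := by
    intro X h
    rw [(ℛ k h).convMul_apply]
    conv_rhs => rw [← sum_counit_smul (ℛ k h)]
    simp [c, Finset.mul_sum]
  have hc' : ∀ (X : WithConv (H →ₗ[k] Module.End k A)) (h : H), (X * c) h = X h * l s := by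
    intro X h
    rw [(ℛ k h).convMul_apply]
    have e : h = ∑ i ∈ (ℛ k h).index, counit (R := k) ((ℛ k h).right i) • (ℛ k h).left i := by
      have := congrArg (TensorProduct.rid k H) (sum_tmul_counit_eq (ℛ k h))
      simp only [map_sum, TensorProduct.rid_tmul, one_smul] at this
      exact this.symm
    conv_rhs => rw [e]
    simp [c, Finset.sum_mul]
  have key : α * c = convMap l (coact ha s) * α := by
    ext h x
    have h1 := congrArg (fun f => f x) (hc' α h)
    have h2 := congrArg (fun f => f x) ((ℛ k h).convMul_apply (convMap l (coact ha s)) α)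
    refine h1.trans (Eq.trans ?_ h2.symm)
    have h3 := congrArg (fun f => f h) (map_mul (coact ha) s x)
    simp only [(ℛ k h).convMul_apply, coact_apply] at h3
    simp only [LinearMap.sum_apply, convMap_apply, coact_apply]
    simpa [α, l, convMap_apply] using h3
  have h0 : convMap l (coact ha s) * convMap l G = 0 := by rw [← map_mul, hG, map_zero]
  have h1 : c * (β * convMap l G) = 0 := by
    have : convMap l (coact ha s) = α * c * β := by rw [key, mul_assoc, hab, mul_one]
    rw [this] at h0
    calc c * (β * convMap l G) = β * α * (c * (β * convMap l G)) := by rw [hba, one_mul]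
      _ = β * (α * c * β * convMap l G) := by simp only [mul_assoc]
      _ = 0 := by rw [h0, mul_zero]
  have h2 : β * convMap l G = 0 := by
    ext h x
    have := congrArg (fun f => f x) ((hc (β * convMap l G) h).symm.trans (congrArg (fun f => f h) h1))
    have h3 : s * ((β * convMap l G) h x) = 0 := this
    exact (mul_eq_zero.mp h3).resolve_left hs
  have h3 : convMap l G = 0 := by
    rw [← one_mul (convMap l G), ← hab, mul_assoc, h2, mul_zero]
  ext h
  have := congrArg (fun f => f h 1) h3
  have h4 : G h * 1 = 0 := this
  simpa using h4

theorem coact_unit [FiniteDimensional k H] [CommRing A] [IsDomain A] [Algebra k A]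
    (ha : HopfAction k H A) {Q : Type} [Field Q] [Algebra k Q] [Algebra A Q] [IsScalarTower k A Q]
    [IsFractionRing A Q] (s : A) (hs : s ≠ 0) :
    IsUnit (convMap (IsScalarTower.toAlgHom k A Q) (coact ha s)) := by
  set j := IsScalarTower.toAlgHom k A Q
  set r := convMap j (coact ha s)
  have inj : ∀ G : WithConv (H →ₗ[k] Q), r * G = 0 → G = 0 := by
    intro G hG
    let b := Module.finBasis k H
    obtain ⟨d, hd⟩ := IsLocalization.exist_integer_multiples_of_finite (nonZeroDivisors A)
      (fun i => G (b i))
    choose g hg using hd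
    let G' : WithConv (H →ₗ[k] A) := toConv (b.constr k g)
    have hd0 : algebraMap A Q d ≠ 0 := by simp
    have e : convMap j G' = (algebraMap A Q d) • G := by
      apply WithConv.ext
      apply b.ext
      intro i
      have : convMap j G' (b i) = algebraMap A Q (G' (b i)) := rfl
      refine this.trans ?_
      have h5 : G' (b i) = g i := by simp [G']
      rw [h5, hg]
      exact algebraMap_smul Q _ _ |>.symm
    have h1 : convMap j (coact ha s * G') = 0 := by
      rw [map_mul, e, mul_smul_comm, hG, smul_zero]
    have h2 : coact ha s * G' = 0 := by
      ext h
      have := congrArg (fun f => f h) h1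
      have h3 : algebraMap A Q ((coact ha s * G') h) = 0 := this
      exact (map_eq_zero_iff _ (IsFractionRing.injective A Q)).mp h3
    rw [coact_inj ha s hs G' h2, map_zero] at e
    exact (smul_eq_zero.mp e.symm).resolve_left hd0
  have fin : Module.Finite Q (WithConv (H →ₗ[k] Q)) :=
    Module.Finite.equiv (WithConv.linearEquiv Q (H →ₗ[k] Q)).symm
  let L : WithConv (H →ₗ[k] Q) →ₗ[Q] WithConv (H →ₗ[k] Q) := LinearMap.mulLeft Q r
  have hL : Function.Injective L := by
    rw [injective_iff_map_eq_zero]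
    intro G hG
    exact inj G hG
  have hsur : ∃ X, L X = 1 := (LinearMap.injective_iff_surjective.mp hL) 1
  obtain ⟨X, hX⟩ := hsur
  have hX1 : r * X = 1 := hX
  have hX2 : X * r = 1 := by
    have := inj (X * r - 1) (by rw [mul_sub, ← mul_assoc, hX1]; simp)
    exact sub_eq_zero.mp this
  exact ⟨⟨r, X, hX1, hX2⟩, rfl⟩

/-- Evaluation at one. -/
def evOne [Ring B] [Algebra k B] : WithConv (H →ₗ[k] B) →+* B where
  toFun f := f 1
  map_one' := by simp
  map_zero' := by simp
  map_add' f g := by simp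
  map_mul' f g := by simp [Algebra.TensorProduct.one_def]

/-- The pullback along multiplication. -/
def mulPull [Ring B] [Algebra k B] :
    WithConv (H →ₗ[k] B) →+* WithConv (H →ₗ[k] WithConv (H →ₗ[k] B)) where
  toFun f := toConv ((WithConv.linearEquiv k (H →ₗ[k] B)).symm.toLinearMap ∘ₗ
    (LinearMap.mul k H).flip.compr₂ f.ofConv)
  map_one' := by
    ext h g
    simp [Algebra.smul_def]
    exact Algebra.commutes _ _
  map_zero' := by ext; simp
  map_add' f g := by ext; simp
  map_mul' f f' := by
    ext h g
    have h1 := ((ℛ k g).mul (ℛ k h)).convMul_apply f f'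
    refine h1.trans ?_
    rw [(ℛ k h).convMul_apply, ofConv_sum, LinearMap.sum_apply]
    simp only [(ℛ k g).convMul_apply]
    rw [Coalgebra.Repr.mul_index, Finset.sum_product_right]
    rfl

theorem mulPull_apply [Ring B] [Algebra k B] (f : WithConv (H →ₗ[k] B)) (g h : H) :
    mulPull f h g = f (g * h) := rfl

end HopfExt

open HopfExt WithConv

/-- If a finite dimensional Hopf algebra `H` over `k` acts inner faithfully on a
commutative domain `A`, then the action extends to the quotient field `Q` of `A` (formalized via
any field `Q` with `IsFractionRing A Q`), making `Q` an inner faithful `H`-module field. -/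
theorem hopf_action_extends_to_fraction_field
    (k : Type) [Field k] [IsAlgClosed k] [CharZero k]
    (H : Type) [Ring H] [HopfAlgebra k H] [FiniteDimensional k H]
    (A : Type) [CommRing A] [IsDomain A] [Algebra k A]
    (ha : HopfAction k H A) (hif : InnerFaithful k ha.act.toLinearMap)
    (Q : Type) [Field Q] [Algebra k Q] [Algebra A Q] [IsScalarTower k A Q]
    [IsFractionRing A Q] :
    ∃ hq : HopfAction k H Q,
      InnerFaithful k hq.act.toLinearMap ∧
      ∀ (h : H) (a : A), hq.act h (algebraMap A Q a) = algebraMap A Q (ha.act h a) := by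
  classical
  let j := IsScalarTower.toAlgHom k A Q
  obtain ⟨F, hF⟩ := extend_exists (Q := Q) ((convMap (H := H) j).comp (coact ha))
    (fun s hs => coact_unit ha s hs)
  have hF' : ∀ (a : A) (h : H), F (algebraMap A Q a) h = algebraMap A Q (ha.act h a) := by
    intro a h
    rw [hF]; rfl
  have hFc : ∀ c : k, F (algebraMap k Q c) = algebraMap k _ c := by
    intro c
    rw [IsScalarTower.algebraMap_apply k A Q]
    ext h
    refine (hF' _ _).trans ?_
    rw [Algebra.algebraMap_eq_smul_one (A := A) c, map_smul, ha.act_one]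
    simp [← Algebra.algebraMap_eq_smul_one, ← IsScalarTower.algebraMap_apply, Algebra.smul_def]
  let Fa : Q →ₐ[k] WithConv (H →ₗ[k] Q) := { F with commutes' := hFc }
  have hone : (evOne (k := k) (H := H)).comp F = RingHom.id Q := by
    apply ext_frac (A := A)
    intro a
    refine (hF' a 1).trans ?_
    simp
  have hmul : (mulPull (k := k) (H := H)).comp F = (convMap Fa).comp F := by
    apply ext_frac (A := A)
    intro a
    ext h g
    refine (hF' a (g * h)).trans ?_
    have e : (F (algebraMap A Q a) h) = algebraMap A Q (ha.act h a) := hF' a h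
    have e2 : ((convMap Fa).comp F) (algebraMap A Q a) h = F (F (algebraMap A Q a) h) := rfl
    refine Eq.trans ?_ (congrArg (fun f => f g) e2).symm
    simp only [e]
    refine Eq.trans ?_ (hF' _ _).symm
    rw [map_mul]; rfl
  let ρ : H →ₗ[k] Q →ₗ[k] Q :=
    ((WithConv.linearEquiv k (H →ₗ[k] Q)).toLinearMap ∘ₗ Fa.toLinearMap).flip
  have hρ : ∀ h q, ρ h q = F q h := fun _ _ => rfl
  let act : H →ₐ[k] Module.End k Q := AlgHom.ofLinearMap ρ
    (by
      ext q
      exact congrArg (fun f => f q) hone)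
    (by
      intro g h
      ext q
      exact congrArg (fun f => f q h g) hmul)
  let hq : HopfAction k H Q :=
    { act := act
      act_mul := by
        intro h a b
        exact congrArg (fun f => f h) (map_mul F a b)
      act_one := by
        intro h
        rw [← Algebra.algebraMap_eq_smul_one]
        exact congrArg (fun f => f h) (map_one F) }
  have hext : ∀ (h : H) (a : A), hq.act h (algebraMap A Q a) = algebraMap A Q (ha.act h a) :=
    fun h a => hF' a h
  refine ⟨hq, ?_, hext⟩
  intro I hI
  apply hif I
  intro x hx
  ext a
  apply IsFractionRing.injective A Q
  have h1 : hq.act x = 0 := hI x hx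
  have := hext x a
  rw [h1] at this
  simpa using this.symm
end

section
/- Let H be a finite dimensional pointed Hopf algebra over k with group of grouplike elements G = G(H), and assume H acts on a commutative domain A as a left H-module algebra. Then A^H = A^G, where A^G = {a ∈ A : g·a = a for all g ∈ G}. -/
open TensorProduct

namespace PtInv

/-- iterated commutator -/
lemma ad_mul {R : Type*} [Ring R] (D : R →+ R) (hD : ∀ x y, D (x * y) = D x * y + x * D y)
    (T : R) (hT : D (D T) = 0) (n : ℕ) (Y : R) :
    D^[n+1] (T * Y) = T * D^[n+1] Y + ((n+1 : ℕ) : R) * (D T * D^[n] Y) := by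
  induction n generalizing Y with
  | zero => simp [hD, add_comm]
  | succ n ih =>
    rw [Function.iterate_succ_apply', ih, map_add, hD, ← nsmul_eq_mul, map_nsmul, hD, hT,
      ← Function.iterate_succ_apply' D, ← Function.iterate_succ_apply' D, zero_mul, zero_add,
      ← nsmul_eq_mul, succ_nsmul _ (n+1)]
    abel

lemma ad_pow_zero {R : Type*} [Ring R] (D : R →+ R) (hD : ∀ x y, D (x * y) = D x * y + x * D y)
    (T : R) (hT : D (D T) = 0) (m : ℕ) : D^[m+1] (T ^ m) = 0 := by
  induction m with
  | zero =>
    have := hD 1 1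
    simpa using this
  | succ m ih =>
    rw [pow_succ', ad_mul D hD T hT, ih, Function.iterate_succ_apply', ih]
    simp

lemma ad_pow {R : Type*} [Ring R] (D : R →+ R) (hD : ∀ x y, D (x * y) = D x * y + x * D y)
    (T : R) (hT : D (D T) = 0) (m : ℕ) : D^[m] (T ^ m) = (m.factorial : R) * (D T) ^ m := by
  induction m with
  | zero => simp
  | succ m ih =>
    rw [pow_succ', ad_mul D hD T hT, ih, ad_pow_zero D hD T hT, Nat.factorial_succ,
      pow_succ' (D T), Nat.cast_mul]
    rw [mul_zero, zero_add, ← mul_assoc (D T), ← (Nat.cast_commute m.factorial (D T)).eq]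
    simp only [mul_assoc]

lemma ad_pow_lt {R : Type*} [Ring R] (D : R →+ R) (hD : ∀ x y, D (x * y) = D x * y + x * D y)
    (T : R) (hT : D (D T) = 0) (m n : ℕ) (h : m < n) : D^[n] (T ^ m) = 0 := by
  obtain ⟨c, rfl⟩ := Nat.exists_eq_add_of_lt h
  rw [show m + c + 1 = c + (m+1) by ring, Function.iterate_add_apply, ad_pow_zero D hD T hT]
  exact Function.iterate_fixed (map_zero D) c

lemma deriv_zero {k A : Type*} [Field k] [CharZero k] [CommRing A] [IsDomain A] [Algebra k A]
    (T : Module.End k A) (hT : IsIntegral k T) (b : A)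
    (h : ∀ a, T (b * a) = T b * a + b * T a) : T b = 0 := by
  let M : Module.End k A := LinearMap.mulLeft k b
  let D : Module.End k A →ₗ[k] Module.End k A :=
    LinearMap.mulRight k M - LinearMap.mulLeft k M
  have hD' : ∀ x, D x = x * M - M * x := fun x => rfl
  have hD : ∀ x y, D (x * y) = D x * y + x * D y := by
    intro x y; simp only [hD', sub_mul, mul_sub, mul_assoc]; abel
  have hDT : D T = LinearMap.mulLeft k (T b) := by
    ext a; simp [hD', M, h]
  have hDDT : D (D T) = 0 := by
    rw [hDT, hD']; ext a; simp [M]; ring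
  obtain ⟨p, hp, hpT⟩ := hT
  have key : ∀ n, ((D : Module.End k A →+ Module.End k A))^[n] = ⇑(D ^ n) := by
    intro n; ext1 x; rw [Module.End.pow_apply]; rfl
  have h1 : (D ^ p.natDegree) (Polynomial.aeval T p) = 0 := by
    rw [Polynomial.aeval_def, hpT, map_zero]
  rw [Polynomial.aeval_eq_sum_range, map_sum, Finset.sum_range_succ, Finset.sum_eq_zero] at h1
  · rw [zero_add, map_smul, ← key, ad_pow _ hD T hDDT, Polynomial.coeff_natDegree, hp.leadingCoeff,
      one_smul] at h1
    have h2 := congrArg (fun f : Module.End k A => f 1) h1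
    simp only [AddMonoidHom.coe_coe, hDT, LinearMap.pow_mulLeft] at h2
    rw [← nsmul_eq_mul] at h2
    have : CharZero A := charZero_of_injective_algebraMap (algebraMap k A).injective
    simp [Nat.factorial_ne_zero] at h2
    exact h2.1
  · intro i hi
    rw [map_smul, ← key, ad_pow_lt _ hD T hDDT _ _ (Finset.mem_range.1 hi), smul_zero]

lemma mem_jacobson {R : Type} [Ring R] [IsArtinianRing R] (x : R)
    (h : ∀ (S : Type) [Ring S] [IsSimpleRing S] (φ : R →+* S), Function.Surjective φ → φ x = 0) :
    x ∈ Ring.jacobson R := by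
  obtain ⟨n, D, d, _, hd, ⟨e⟩⟩ :=
    IsSemisimpleRing.exists_ringEquiv_pi_matrix_divisionRing (R ⧸ Ring.jacobson R)
  rw [← Ideal.Quotient.eq_zero_iff_mem]
  apply e.injective
  rw [map_zero]
  ext1 i
  have := hd i
  refine h _ (((Pi.evalRingHom _ i).comp e.toRingHom).comp (Ideal.Quotient.mk _)) ?_
  exact ((Function.surjective_eval i).comp e.surjective).comp Ideal.Quotient.mk_surjective

lemma exists_chain (R : Type) [Ring R] [IsArtinianRing R] :
    ∃ (n : ℕ) (I : ℕ → Ideal R), I 0 = ⊤ ∧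
      (∀ i a b, a ∈ Ring.jacobson R → b ∈ I i → a * b ∈ I (i+1)) ∧ I n = ⊥ := by
  obtain ⟨n, hn⟩ := IsSemiprimaryRing.isNilpotent (R := R)
  refine ⟨n, fun i => Ring.jacobson R ^ i, ?_, ?_, hn⟩
  · exact (Submodule.pow_zero _).trans Ideal.one_eq_top
  · intro i a b h1 h2
    simp only [Ideal.IsTwoSided.pow_succ]
    exact Ideal.mul_mem_mul h1 h2

section Coalg
open WithConv Coalgebra
variable {k H : Type} [Field k] [Ring H] [HopfAlgebra k H]

/-- right slice -/
noncomputable def rsl (f : H →ₗ[k] k) : H ⊗[k] H →ₗ[k] H :=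
  (TensorProduct.rid k H).toLinearMap ∘ₗ LinearMap.lTensor H f
/-- left slice -/
noncomputable def lsl (f : H →ₗ[k] k) : H ⊗[k] H →ₗ[k] H :=
  (TensorProduct.lid k H).toLinearMap ∘ₗ LinearMap.rTensor H f

@[simp] lemma rsl_tmul (f : H →ₗ[k] k) (x y : H) : rsl f (x ⊗ₜ y) = f y • x := by simp [rsl]
@[simp] lemma lsl_tmul (f : H →ₗ[k] k) (x y : H) : lsl f (x ⊗ₜ y) = f x • y := by simp [lsl]

lemma rsl_conv (f g : WithConv (H →ₗ[k] k)) (x : H) :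
    f.ofConv (rsl g.ofConv (comul x)) = (f * g).ofConv x := by
  change _ = LinearMap.mul' k k (TensorProduct.map f.ofConv g.ofConv (comul x))
  generalize (comul x : H ⊗[k] H) = t
  induction t with
  | zero => simp
  | tmul a b => simp [mul_comm]
  | add a b ha hb => simp [ha, hb]

lemma lsl_conv (f g : WithConv (H →ₗ[k] k)) (x : H) :
    g.ofConv (lsl f.ofConv (comul x)) = (f * g).ofConv x := by
  change _ = LinearMap.mul' k k (TensorProduct.map f.ofConv g.ofConv (comul x))
  generalize (comul x : H ⊗[k] H) = t
  induction t with
  | zero => simp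
  | tmul a b => simp
  | add a b ha hb => simp [ha, hb]

lemma sep {x y : H} (h : ∀ f : H →ₗ[k] k, f x = f y) : x = y := by
  rw [← sub_eq_zero, ← Module.forall_dual_apply_eq_zero_iff k]
  intro f; simp [h]

lemma rsl_mul (f g : WithConv (H →ₗ[k] k)) (x : H) :
    rsl f.ofConv (comul (rsl g.ofConv (comul x))) = rsl (f * g).ofConv (comul x) := by
  apply sep (k := k)
  intro l
  have h1 := rsl_conv (toConv l) f (rsl g.ofConv (comul x))
  have h2 := rsl_conv (toConv l) (f * g) x
  rw [rsl_conv (toConv l * f) g x, mul_assoc] at h1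
  exact h1.trans h2.symm

variable [FiniteDimensional k H]

lemma expand_r (t : H ⊗[k] H) :
    t = ∑ i, rsl ((Module.finBasis k H).coord i) t ⊗ₜ[k] (Module.finBasis k H i) := by
  induction t with
  | zero => simp
  | tmul a b =>
    simp only [rsl_tmul, TensorProduct.smul_tmul]
    rw [← TensorProduct.tmul_sum]
    congr 1
    exact ((Module.finBasis k H).sum_repr b).symm
  | add a b ha hb =>
    conv_lhs => rw [ha, hb]
    simp [TensorProduct.add_tmul, Finset.sum_add_distrib]

lemma expand_l (t : H ⊗[k] H) :
    t = ∑ i, (Module.finBasis k H i) ⊗ₜ[k] lsl ((Module.finBasis k H).coord i) t := by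
  induction t with
  | zero => simp
  | tmul a b =>
    simp only [lsl_tmul, ← TensorProduct.smul_tmul]
    rw [← TensorProduct.sum_tmul]
    congr 1
    exact ((Module.finBasis k H).sum_repr a).symm
  | add a b ha hb =>
    conv_lhs => rw [ha, hb]
    simp [TensorProduct.tmul_add, Finset.sum_add_distrib]

lemma mem_range_of_slices (V : Submodule k H) (t : H ⊗[k] H)
    (hr : ∀ f, rsl f t ∈ V) (hl : ∀ f, lsl f t ∈ V) :
    t ∈ LinearMap.range (TensorProduct.map V.subtype V.subtype) := by
  obtain ⟨π, hπ⟩ := V.exists_isCompl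
  let p : H →ₗ[k] V := V.projectionOnto π hπ
  have hp : ∀ x ∈ V, (p x : H) = x := fun x hx => by
    have := Submodule.projectionOnto_apply_left hπ ⟨x, hx⟩
    exact congrArg Subtype.val this
  have h1 : TensorProduct.map (V.subtype ∘ₗ p) LinearMap.id t = t := by
    conv_lhs => rw [expand_r t]
    conv_rhs => rw [expand_r t]
    simp [hp _ (hr _)]
  have h2 : TensorProduct.map LinearMap.id (V.subtype ∘ₗ p) t = t := by
    conv_lhs => rw [expand_l t]
    conv_rhs => rw [expand_l t]
    simp [hp _ (hl _)]
  refine ⟨TensorProduct.map p p t, ?_⟩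
  rw [← LinearMap.comp_apply, ← TensorProduct.map_comp]
  conv_rhs => rw [← h1, ← h2]
  rw [← LinearMap.comp_apply, ← TensorProduct.map_comp]
  simp

lemma conv_eq_zero_of_sub (W : Submodule k H) (hW : IsSubcoalgebra k W)
    (f g : WithConv (H →ₗ[k] k))
    (h : (∀ x ∈ W, f.ofConv x = 0) ∨ (∀ x ∈ W, g.ofConv x = 0)) (x : H) (hx : x ∈ W) :
    (f * g).ofConv x = 0 := by
  change LinearMap.mul' k k (TensorProduct.map f.ofConv g.ofConv (comul x)) = 0
  obtain ⟨s, hs⟩ := hW x hx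
  rw [← hs, ← LinearMap.comp_apply (TensorProduct.map f.ofConv g.ofConv),
    ← TensorProduct.map_comp]
  rcases h with h | h
  · have : f.ofConv ∘ₗ W.subtype = 0 := by ext y; exact h y y.2
    rw [this]; simp
  · have : g.ofConv ∘ₗ W.subtype = 0 := by ext y; exact h y y.2
    rw [this]; simp

/-- kernel of a ring hom as a subspace of the dual -/
noncomputable def kerDual {S : Type} [Ring S] (φ : WithConv (H →ₗ[k] k) →+* S) :
    Submodule k (Module.Dual k H) where
  carrier := {f | φ (toConv f) = 0}
  zero_mem' := by simp
  add_mem' {a b} ha hb := by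
    simp only [Set.mem_ofPred_eq] at *
    rw [toConv_add, map_add, ha, hb, add_zero]
  smul_mem' c x hx := by
    simp only [Set.mem_ofPred_eq] at *
    have h : ∀ f : WithConv (H →ₗ[k] k), φ f = 0 → φ (c • f) = 0 := by
      intro f hf
      have h1 : c • f = algebraMap k _ c * f := Algebra.smul_def c f
      rw [h1, map_mul, hf, mul_zero]
    exact h _ hx

lemma simple_of_surj {S : Type} [Ring S] [IsSimpleRing S] (φ : WithConv (H →ₗ[k] k) →+* S)
    (hφ : Function.Surjective φ) :
    IsSimpleSubcoalgebra k (kerDual φ).dualCoannihilator := by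
  have hdd : (kerDual φ).dualCoannihilator.dualAnnihilator = kerDual φ :=
    Subspace.dualCoannihilator_dualAnnihilator_eq
  refine ⟨?_, ?_, ?_⟩
  · intro x hx
    rw [Submodule.mem_dualCoannihilator] at hx
    apply mem_range_of_slices
    · intro f
      rw [Submodule.mem_dualCoannihilator]
      intro l hl
      have := rsl_conv (toConv l) (toConv f) x
      refine this.trans (hx (toConv l * toConv f).ofConv ?_)
      change φ (toConv l * toConv f) = 0
      rw [map_mul, show φ (toConv l) = 0 from hl, zero_mul]
    · intro f
      rw [Submodule.mem_dualCoannihilator]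
      intro l hl
      have := lsl_conv (toConv f) (toConv l) x
      refine this.trans (hx (toConv f * toConv l).ofConv ?_)
      change φ (toConv f * toConv l) = 0
      rw [map_mul, show φ (toConv l) = 0 from hl, mul_zero]
  · intro h
    rw [h, Submodule.dualAnnihilator_bot] at hdd
    have h1 : (1 : WithConv (H →ₗ[k] k)).ofConv ∈ kerDual φ := hdd ▸ Submodule.mem_top
    have h2 : φ 1 = 0 := h1
    rw [map_one] at h2
    exact one_ne_zero h2
  · intro W hW hWV
    have hP : kerDual φ ≤ W.dualAnnihilator := by
      rw [← hdd]; exact Submodule.dualAnnihilator_anti hWV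
    let I : Ideal (WithConv (H →ₗ[k] k)) :=
      { carrier := {f | ∀ x ∈ W, f.ofConv x = 0}
        zero_mem' := by intro x _; simp
        add_mem' := by
          intro a b ha hb x hx
          rw [ofConv_add, LinearMap.add_apply, ha x hx, hb x hx, add_zero]
        smul_mem' := by
          intro c f hf x hx
          exact conv_eq_zero_of_sub W hW c f (Or.inr hf) x hx }
    have hI : I.IsTwoSided := ⟨fun {a} b ha x hx =>
      conv_eq_zero_of_sub W hW a b (Or.inl ha) x hx⟩
    have : RingHomSurjective φ := ⟨hφ⟩
    rcases (isSimpleRing_iff_isTwoSided_imp.1 ‹IsSimpleRing S›).2 (I.map φ) inferInstance with h | h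
    · right
      refine le_antisymm hWV ?_
      have h3 : W.dualAnnihilator ≤ kerDual φ := by
        intro f hf
        have h4 : toConv f ∈ I := fun x hx => (Submodule.mem_dualAnnihilator f).1 hf x hx
        have h5 := Ideal.mem_map_of_mem φ h4
        rw [h] at h5
        exact h5
      have := Submodule.dualCoannihilator_anti h3
      rwa [Subspace.dualAnnihilator_dualCoannihilator_eq] at this
    · left
      have h1 : (1 : S) ∈ I.map φ := h ▸ Submodule.mem_top
      rw [Ideal.mem_map_iff_of_surjective φ hφ] at h1
      obtain ⟨f, hf, hf1⟩ := h1
      have h2 : (1 - f) ∈ I := by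
        have : (1 - f).ofConv ∈ kerDual φ := by
          change φ (1 - f) = 0
          rw [map_sub, map_one, hf1, sub_self]
        intro x hx
        exact (Submodule.mem_dualAnnihilator _).1 (hP this) x hx
      have h3 : (1 : WithConv (H →ₗ[k] k)) ∈ I := by
        have := I.add_mem h2 hf
        rwa [sub_add_cancel] at this
      rw [eq_bot_iff]
      intro x hx
      rw [Submodule.mem_bot]
      apply sep (k := k)
      intro l
      have h4 := I.mul_mem_left (toConv l) h3
      rw [mul_one] at h4
      rw [map_zero]
      exact h4 x hx

lemma elem {g : H} (hg : IsGrouplike k g) : IsGroupLikeElem k g := by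
  refine ⟨?_, hg.2⟩
  have h := Coalgebra.rTensor_counit_comul (R := k) g
  rw [hg.2] at h
  have h2 := congrArg (TensorProduct.lid k H) h
  simp only [LinearMap.rTensor_tmul, TensorProduct.lid_tmul, one_smul] at h2
  have : (counit (R := k) g - 1) • g = 0 := by rw [sub_smul, h2, one_smul, sub_self]
  rcases smul_eq_zero.1 this with h | h
  · exact sub_eq_zero.1 h
  · exact (hg.1 h).elim

lemma conv_grouplike {g : H} (hg : IsGrouplike k g) (f l : WithConv (H →ₗ[k] k)) :
    (f * l).ofConv g = f.ofConv g * l.ofConv g := by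
  change LinearMap.mul' k k (TensorProduct.map f.ofConv l.ofConv (comul g)) = _
  rw [hg.2]; simp

lemma mem_jac_of_pointed (hpt : IsPointedHopf k H) [IsArtinianRing (WithConv (H →ₗ[k] k))]
    (f : WithConv (H →ₗ[k] k))
    (hf : ∀ g : H, IsGrouplike k g → f.ofConv g = 0) : f ∈ Ring.jacobson (WithConv (H →ₗ[k] k)) := by
  apply mem_jacobson
  intro S _ _ φ hφ
  have h1 := simple_of_surj φ hφ
  have h2 : (kerDual φ).dualCoannihilator ≤ Submodule.span k {g : H | IsGrouplike k g} := by
    rw [← hpt]; exact le_sSup h1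
  have h3 := Submodule.dualAnnihilator_anti h2
  rw [Subspace.dualCoannihilator_dualAnnihilator_eq] at h3
  have h4 : f.ofConv ∈ kerDual φ := by
    apply h3
    rw [Submodule.mem_dualAnnihilator]
    intro w hw
    have : Submodule.span k {g : H | IsGrouplike k g} ≤ LinearMap.ker f.ofConv :=
      Submodule.span_le.2 fun g hg => hf g hg
    exact this hw
  exact h4

lemma exists_elem (hpt : IsPointedHopf k H) (C : Submodule k H) (hC : C ≠ ⊤) :
    ∃ h g : H, h ∉ C ∧ IsGrouplike k g ∧
      ∀ f : H →ₗ[k] k, rsl f (comul h) - f g • h ∈ C := by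
  have : Module.Finite k (WithConv (H →ₗ[k] k)) :=
    Module.Finite.equiv (WithConv.linearEquiv k (H →ₗ[k] k)).symm
  have : IsArtinianRing (WithConv (H →ₗ[k] k)) := IsArtinianRing.of_finite k _
  have step : ∃ x, x ∉ C ∧ ∀ f : WithConv (H →ₗ[k] k), (∀ g : H, IsGrouplike k g → f.ofConv g = 0) →
      rsl f.ofConv (comul x) ∈ C := by
    by_contra hcon
    push Not at hcon
    obtain ⟨n, I, hI0, hIs, hIn⟩ := exists_chain (WithConv (H →ₗ[k] k))
    have key : ∀ i x, (∀ f ∈ I i, rsl (WithConv.ofConv f) (comul x) ∈ C) → x ∈ C := by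
      intro i
      induction i with
      | zero =>
        intro x hx
        have h1 := hx 1 (by rw [hI0]; exact Submodule.mem_top)
        have h2 : rsl (1 : WithConv (H →ₗ[k] k)).ofConv (comul x) = x := by
          apply sep (k := k)
          intro l
          have := rsl_conv (toConv l) 1 x
          rwa [mul_one] at this
        rwa [h2] at h1
      | succ i ih =>
        intro x hx
        apply ih
        intro f hf
        by_contra hfC
        obtain ⟨l, hl, hl2⟩ := hcon _ hfC
        apply hl2
        rw [rsl_mul]
        apply hx
        exact hIs _ _ _ (mem_jac_of_pointed hpt l hl) hf
    apply hC
    rw [eq_top_iff]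
    intro x _
    apply key n
    intro f hf
    have : f = 0 := by
      rw [hIn] at hf; exact hf
    rw [this]
    have : rsl (0 : WithConv (H →ₗ[k] k)).ofConv = 0 := by
      ext; simp
    rw [this]; simp
  obtain ⟨x, hxC, hx⟩ := step
  have hli : LinearIndepOn k id {a : H | IsGroupLikeElem k a} := linearIndepOn_isGroupLikeElem
  have hfin : {a : H | IsGroupLikeElem k a}.Finite := hli.finite
  have : Fintype {a : H | IsGroupLikeElem k a} := hfin.fintype
  classical
  have hdual : ∀ g : {a : H | IsGroupLikeElem k a}, ∃ e : H →ₗ[k] k,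
      ∀ g' : {a : H | IsGroupLikeElem k a}, e g' = if g' = g then 1 else 0 := by
    intro g
    let b := Module.Basis.span hli
    let e0 := b.coord g
    obtain ⟨e, he⟩ := LinearMap.exists_extend e0
    refine ⟨e, fun g' => ?_⟩
    have h1 := LinearMap.congr_fun he (b g')
    have h2 : (b g' : H) = g' := congrArg Subtype.val (Module.Basis.span_apply hli g')
    simp only [LinearMap.comp_apply, Submodule.subtype_apply, h2] at h1
    rw [h1]
    simp [e0, Finsupp.single_apply]
  choose e he using hdual
  have hrsl : ∀ (f l : H →ₗ[k] k), rsl (f - l) (comul x) = rsl f (comul x) - rsl l (comul x) := by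
    intro f l; simp [rsl, LinearMap.lTensor_sub]
  have hsum : rsl (∑ g, e g) (comul x) = ∑ g, rsl (e g) (comul x) := by
    simp only [rsl, LinearMap.comp_apply, ← LinearMap.coe_lTensorHom, map_sum, LinearMap.sum_apply]
  have hcounit : rsl (counit (R := k)) (comul x) = x := by
    simp [rsl]
  have h1 := hx (toConv (counit (R := k) - ∑ g, e g)) (by
    intro g hg
    have := (elem hg).counit_eq_one
    simp [this]
    have h := fun i => he i ⟨g, (elem hg)⟩
    simp only [] at h
    simp [h])
  rw [ofConv_toConv, hrsl, hcounit, hsum] at h1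
  have h2 : ∃ g, rsl (e g) (comul x) ∉ C := by
    by_contra hcon
    push Not at hcon
    apply hxC
    have := C.add_mem h1 (C.sum_mem (fun g (_ : g ∈ Finset.univ) => hcon g))
    rwa [sub_add_cancel] at this
  obtain ⟨g, hg⟩ := h2
  refine ⟨_, g, hg, ⟨g.2.ne_zero, g.2.comul_eq_tmul_self⟩, fun f => ?_⟩
  have h3 := rsl_mul (toConv f) (toConv (e g)) x
  simp only at h3
  rw [h3]
  have h4 : f (g : H) • rsl (e g) (comul x) = rsl (f (g : H) • e g) (comul x) := by
    simp [rsl]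
  rw [h4, ← hrsl]
  refine hx (toConv ((toConv f * toConv (e g)).ofConv - f (g : H) • e g)) ?_
  intro g' hg'
  rw [ofConv_toConv, LinearMap.sub_apply, conv_grouplike hg']
  have h := he g ⟨g', (elem hg')⟩
  simp only at h
  simp only [LinearMap.smul_apply, h, smul_eq_mul]
  split_ifs with h5
  · have : g' = g := congrArg Subtype.val h5
    rw [this]; simp
  · simp

end Coalg

section Main
open Coalgebra
variable {k H A : Type} [Field k] [Ring H] [HopfAlgebra k H] [FiniteDimensional k H]
  [CommRing A] [Algebra k A] (ha : HopfAction k H A)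

lemma act_grouplike {g : H} (hg : comul (R := k) g = g ⊗ₜ[k] g) (a b : A) :
    ha.act g (a * b) = ha.act g a * ha.act g b := by
  rw [ha.act_mul, hg]; simp

lemma act_formula (h g : H) (b : A) (C : Submodule k H)
    (hC : ∀ c ∈ C, ha.act c b = counit (R := k) c • b)
    (hh : ∀ f : H →ₗ[k] k, rsl f (comul h) - f g • h ∈ C) (a : A) :
    ha.act h (b * a) = ha.act h b * ha.act g a +
      b * (ha.act h a - counit (R := k) h • ha.act g a) := by
  have key : ∀ t : H ⊗[k] H, (∀ f, rsl f t ∈ C) → LinearMap.mul' k A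
      (TensorProduct.map ((ha.act.toLinearMap : H →ₗ[k] A →ₗ[k] A).flip b)
        ((ha.act.toLinearMap : H →ₗ[k] A →ₗ[k] A).flip a) t) =
        b * ha.act (lsl (counit (R := k)) t) a := by
    intro t ht
    rw [expand_r t]
    simp [hC _ (ht _), Finset.mul_sum]
  have h1 := key (comul h - h ⊗ₜ g) (by intro f; simpa using hh f)
  have h2 : lsl (counit (R := k)) (comul h) = h := by simp [lsl]
  rw [map_sub, map_sub, ← ha.act_mul, map_sub, h2] at h1
  simp at h1
  rw [← sub_eq_iff_eq_add', h1]

lemma main_step [CharZero k] [IsDomain A] (h g : H) (hg : IsGrouplike k g) (b : A)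
    (hb : ∀ g : H, IsGrouplike k g → ha.act g b = b) (C : Submodule k H)
    (hC : ∀ c ∈ C, ha.act c b = counit (R := k) c • b)
    (hh : ∀ f : H →ₗ[k] k, rsl f (comul h) - f g • h ∈ C) :
    ha.act h b = counit (R := k) h • b := by
  have hg' := elem hg
  let s := HopfAlgebra.antipode k g
  have hs : IsGroupLikeElem k s := hg'.antipode
  have hsg : ∀ a, ha.act s (ha.act g a) = a := by
    intro a
    rw [← Module.End.mul_apply, ← map_mul, hg'.antipode_mul_cancel, map_one]; rfl
  have hgs : ∀ a, ha.act g (ha.act s a) = a := by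
    intro a
    rw [← Module.End.mul_apply, ← map_mul, hg'.mul_antipode_cancel, map_one]; rfl
  have hsb : ha.act s b = b := hb s ⟨hs.ne_zero, hs.comul_eq_tmul_self⟩
  have hgb : ha.act g b = b := hb g hg
  let y : H := s * (h - counit (R := k) h • g)
  have hy : ∀ a, ha.act y a = ha.act s (ha.act h a) - counit (R := k) h • a := by
    intro a
    simp [y, hsg]
  have hint : IsIntegral k (ha.act y) := (Algebra.IsIntegral.isIntegral y).map ha.act
  have h0 : ha.act y b = 0 := by
    apply deriv_zero _ hint
    intro a
    rw [hy, hy, hy, act_formula ha h g b C hC hh]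
    simp only [map_add, act_grouplike ha hs.comul_eq_tmul_self, hsg, hsb, map_sub, map_smul]
    simp only [Algebra.smul_def]
    ring
  rw [hy, sub_eq_zero] at h0
  have h1 := congrArg (ha.act g) h0
  rwa [hgs, map_smul, hgb] at h1
end Main

end PtInv

/-- **Statement 7.** Let `H` be a finite dimensional pointed Hopf algebra over `k` with group of
grouplikes `G = G(H)`, acting on a commutative domain `A` as a left `H`-module algebra.
Then `A^H = A^G`. -/
theorem invariants_eq_grouplike_invariants_of_pointed
    (k : Type) [Field k] [IsAlgClosed k] [CharZero k]
    (H : Type) [Ring H] [HopfAlgebra k H] [FiniteDimensional k H]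
    (hpt : IsPointedHopf k H)
    (A : Type) [CommRing A] [IsDomain A] [Algebra k A]
    (ha : HopfAction k H A) :
    ha.invariants = {a : A | ∀ g : H, IsGrouplike k g → ha.act g a = a} := by
  ext b
  constructor
  · intro hb g hg
    rw [hb g, (PtInv.elem hg).counit_eq_one, one_smul]
  · intro hb
    let C : Submodule k H :=
      { carrier := {h | ∀ b : A, (∀ g : H, IsGrouplike k g → ha.act g b = b) →
          ha.act h b = Coalgebra.counit (R := k) h • b}
        zero_mem' := by intro b _; simp
        add_mem' := by
          intro x y hx hy b hb
          rw [map_add, map_add, LinearMap.add_apply, hx b hb, hy b hb, add_smul]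
        smul_mem' := by
          intro c x hx b hb
          rw [map_smul, map_smul, LinearMap.smul_apply, hx b hb, smul_eq_mul, mul_smul] }
    have hC : C = ⊤ := by
      by_contra hne
      obtain ⟨h, g, hh, hg, hf⟩ := PtInv.exists_elem hpt C hne
      apply hh
      intro b hb
      exact PtInv.main_step ha h g hg b hb C (fun c hc => hc b hb) hf
    intro h
    have : h ∈ C := hC ▸ Submodule.mem_top
    exact this b hb
end

section
/- Let H be a finite dimensional pointed Hopf algebra over k with group of grouplike elements G = G(H), acting inner faithfully on a field L ⊇ k as a left H-module algebra. Then the field extension L^H = L^G ⊆ L is a finite Galois extension with Galois group G (in particular, G acts faithfully on L by field automorphisms). -/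
open TensorProduct

section CoalgPart
variable {k : Type} [Field k] {H : Type} [Ring H] [HopfAlgebra k H]

lemma PF.sep {M N : Type} [AddCommGroup M] [Module k M] [AddCommGroup N] [Module k N]
    (t : M ⊗[k] N) (h : ∀ l : N →ₗ[k] k, TensorProduct.rid k M (LinearMap.lTensor M l t) = 0) :
    t = 0 := by
  classical
  let b := Module.Basis.ofVectorSpace k N
  apply (TensorProduct.equivFinsuppOfBasisRight (M := M) b).injective
  rw [map_zero]
  ext i
  rw [Finsupp.zero_apply, ← h (b.coord i)]
  clear h
  induction t with
  | zero => simp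
  | add x y hx hy => simp [hx, hy]
  | tmul x y => simp

lemma PF.sep' {M N : Type} [AddCommGroup M] [Module k M] [AddCommGroup N] [Module k N]
    (t : N ⊗[k] M) (h : ∀ l : N →ₗ[k] k, TensorProduct.lid k M (LinearMap.rTensor M l t) = 0) :
    t = 0 := by
  apply (TensorProduct.comm k N M).injective
  rw [map_zero]
  apply PF.sep
  intro l
  rw [← h l]
  clear h
  induction t with
  | zero => simp
  | add x y hx hy => simp only [map_add, hx, hy]
  | tmul x y => simp

/-- right hit: `x ↦ x₁ f(x₂)`. -/
noncomputable def PF.T (f : H →ₗ[k] k) : Module.End k H :=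
  (TensorProduct.rid k H).toLinearMap ∘ₗ LinearMap.lTensor H f ∘ₗ Coalgebra.comul (R := k)

/-- left hit: `x ↦ f(x₁) x₂`. -/
noncomputable def PF.U (f : H →ₗ[k] k) : Module.End k H :=
  (TensorProduct.lid k H).toLinearMap ∘ₗ LinearMap.rTensor H f ∘ₗ Coalgebra.comul (R := k)

lemma PF.T_repr (f : H →ₗ[k] k) (x : H) {ι : Type*} (r : Coalgebra.Repr k x ι) :
    PF.T f x = ∑ i ∈ r.index, f (r.right i) • r.left i := by
  simp [PF.T, ← r.eq]

lemma PF.U_repr (f : H →ₗ[k] k) (x : H) {ι : Type*} (r : Coalgebra.Repr k x ι) :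
    PF.U f x = ∑ i ∈ r.index, f (r.left i) • r.right i := by
  simp [PF.U, ← r.eq]

lemma PF.counit_T (f : H →ₗ[k] k) (x : H) : Coalgebra.counit (R := k) (PF.T f x) = f x := by
  let r := Coalgebra.Repr.arbitrary k x
  have := congrArg f (Coalgebra.sum_counit_smul (R := k) r)
  rw [PF.T_repr f x r, map_sum, ← this, map_sum]
  simp [mul_comm]

lemma PF.T_counit : PF.T (Coalgebra.counit (R := k) (A := H)) = 1 := by
  ext x
  simp [PF.T]

lemma PF.T_smul (c : k) (f : H →ₗ[k] k) : PF.T (c • f) = c • PF.T f := by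
  ext x
  simp [PF.T]

lemma PF.T_add (f g : H →ₗ[k] k) : PF.T (f + g) = PF.T f + PF.T g := by
  ext x
  simp [PF.T]

lemma PF.comul_T (f : H →ₗ[k] k) (x : H) :
    Coalgebra.comul (R := k) (PF.T f x) = LinearMap.lTensor H (PF.T f) (Coalgebra.comul x) := by
  have h := Coalgebra.coassoc_apply (R := k) x
  have h1 : ∀ t : H ⊗[k] H, Coalgebra.comul (R := k) (TensorProduct.rid k H (LinearMap.lTensor H f t))
      = LinearMap.lTensor H ((TensorProduct.rid k H).toLinearMap ∘ₗ LinearMap.lTensor H f)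
        (TensorProduct.assoc k H H H (LinearMap.rTensor H Coalgebra.comul t)) := by
    intro t
    induction t with
    | zero => simp
    | add x y hx hy => simp only [map_add, hx, hy]
    | tmul x y =>
      simp only [LinearMap.lTensor_tmul, LinearMap.rTensor_tmul, TensorProduct.rid_tmul, map_smul]
      generalize Coalgebra.comul (R := k) x = z
      induction z with
      | zero => simp
      | add a b ha hb => simp only [smul_add, TensorProduct.add_tmul, map_add, ha, hb]
      | tmul a b => simp
  have h2 := h1 (Coalgebra.comul x)
  rw [h] at h2
  change Coalgebra.comul (R := k) (TensorProduct.rid k H (LinearMap.lTensor H f _)) = _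
  rw [h2, ← LinearMap.comp_apply, ← LinearMap.lTensor_comp]
  rfl

lemma PF.T_mul (f g : H →ₗ[k] k) : PF.T (f ∘ₗ PF.T g) = PF.T f * PF.T g := by
  ext x
  simp only [Module.End.mul_apply]
  conv_rhs => rw [PF.T]
  simp only [LinearMap.comp_apply, PF.comul_T]
  simp [PF.T, LinearMap.lTensor_comp]

lemma PF.U_T (f g : H →ₗ[k] k) (x : H) : PF.U f (PF.T g x) = PF.T g (PF.U f x) := by
  conv_lhs => rw [PF.U]
  simp only [LinearMap.comp_apply, PF.comul_T]
  conv_rhs => rw [PF.U]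
  simp only [LinearMap.comp_apply]
  generalize Coalgebra.comul (R := k) x = z
  induction z with
  | zero => simp
  | add a b ha hb => simp only [map_add, ha, hb]
  | tmul a b => simp

lemma PF.apply_U (f g : H →ₗ[k] k) (x : H) : g (PF.U f x) = f (PF.T g x) := by
  let r := Coalgebra.Repr.arbitrary k x
  rw [PF.T_repr g x r, PF.U_repr f x r, map_sum, map_sum]
  simp [mul_comm]

variable (k H) in
/-- the algebra of right hits. -/
noncomputable def PF.Rs : Subalgebra k (Module.End k H) where
  carrier := Set.range (PF.T (k := k) (H := H))
  mul_mem' := by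
    rintro _ _ ⟨f, rfl⟩ ⟨g, rfl⟩
    exact ⟨_, PF.T_mul f g⟩
  add_mem' := by
    rintro _ _ ⟨f, rfl⟩ ⟨g, rfl⟩
    exact ⟨_, PF.T_add f g⟩
  algebraMap_mem' := by
    intro c
    refine ⟨c • Coalgebra.counit, ?_⟩
    rw [PF.T_smul, PF.T_counit, Algebra.algebraMap_eq_smul_one]

variable (k H) in
/-- the algebra of right hits as a type. -/
def PF.R : Type := PF.Rs k H

noncomputable instance : Ring (PF.R k H) := inferInstanceAs (Ring (PF.Rs k H))

noncomputable instance : Algebra k (PF.R k H) := inferInstanceAs (Algebra k (PF.Rs k H))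

instance [FiniteDimensional k H] : Module.Finite k (PF.R k H) :=
  inferInstanceAs (Module.Finite k (PF.Rs k H))

/-- inclusion -/
noncomputable def PF.incl : PF.R k H →ₐ[k] Module.End k H := (PF.Rs k H).val

noncomputable instance : Module (PF.R k H) H := Module.compHom H (PF.incl (k := k) (H := H)).toRingHom

lemma PF.smul_def (r : PF.R k H) (x : H) : r • x = PF.incl r x := rfl

instance : IsScalarTower k (PF.R k H) H := ⟨by
  intro c r x
  rw [PF.smul_def, PF.smul_def, map_smul]
  rfl⟩

instance : SMulCommClass (PF.R k H) k H := ⟨by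
  intro r c x
  rw [PF.smul_def, PF.smul_def, map_smul]⟩

lemma PF.incl_inj : Function.Injective (PF.incl (k := k) (H := H)) := Subtype.val_injective

/-- hit as element of R -/
noncomputable def PF.TR (f : H →ₗ[k] k) : PF.R k H := (⟨PF.T f, f, rfl⟩ : PF.Rs k H)

lemma PF.incl_TR (f : H →ₗ[k] k) : PF.incl (PF.TR f) = PF.T f := rfl

lemma PF.TR_smul (f : H →ₗ[k] k) (x : H) : PF.TR f • x = PF.T f x := rfl

lemma PF.exists_TR (r : PF.R k H) : ∃ f, r = PF.TR f := by
  obtain ⟨r, f, rfl⟩ := r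
  exact ⟨f, rfl⟩

lemma PF.isSub_of_stable (V : Submodule k H) (h1 : ∀ f : H →ₗ[k] k, ∀ x ∈ V, PF.T f x ∈ V)
    (h2 : ∀ f : H →ₗ[k] k, ∀ x ∈ V, PF.U f x ∈ V) : IsSubcoalgebra k V := by
  intro x hx
  obtain ⟨q, hq⟩ := V.subtype.exists_leftInverse_of_injective V.ker_subtype
  have hq' : ∀ y ∈ V, ((q y : V) : H) = y := fun y hy => by
    have := LinearMap.congr_fun hq ⟨y, hy⟩
    simpa using congrArg Subtype.val this
  have e1 : LinearMap.rTensor H (V.subtype ∘ₗ q) (Coalgebra.comul (R := k) x)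
      = Coalgebra.comul (R := k) x := by
    rw [← sub_eq_zero]
    apply PF.sep
    intro l
    rw [map_sub, map_sub, sub_eq_zero]
    change _ = PF.T l x
    have : ∀ t : H ⊗[k] H, TensorProduct.rid k H (LinearMap.lTensor H l
        (LinearMap.rTensor H (V.subtype ∘ₗ q) t)) = (q (TensorProduct.rid k H (LinearMap.lTensor H l t)) : H) := by
      intro t
      induction t with
      | zero => simp
      | add x y hx hy => simp only [map_add, hx, hy, Submodule.coe_add]
      | tmul x y => simp
    rw [this]
    exact hq' _ (h1 l x hx)
  have e2 : LinearMap.lTensor H (V.subtype ∘ₗ q) (Coalgebra.comul (R := k) x)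
      = Coalgebra.comul (R := k) x := by
    rw [← sub_eq_zero]
    apply PF.sep'
    intro l
    rw [map_sub, map_sub, sub_eq_zero]
    change _ = PF.U l x
    have : ∀ t : H ⊗[k] H, TensorProduct.lid k H (LinearMap.rTensor H l
        (LinearMap.lTensor H (V.subtype ∘ₗ q) t)) = (q (TensorProduct.lid k H (LinearMap.rTensor H l t)) : H) := by
      intro t
      induction t with
      | zero => simp
      | add x y hx hy => simp only [map_add, hx, hy, Submodule.coe_add]
      | tmul x y => simp
    rw [this]
    exact hq' _ (h2 l x hx)
  refine ⟨TensorProduct.map q q (Coalgebra.comul (R := k) x), ?_⟩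
  rw [← LinearMap.comp_apply, ← TensorProduct.map_comp]
  rw [← LinearMap.lTensor_comp_rTensor, LinearMap.comp_apply, e1, e2]

lemma PF.stable_T (V : Submodule k H) (hV : IsSubcoalgebra k V) (f : H →ₗ[k] k) (x : H)
    (hx : x ∈ V) : PF.T f x ∈ V := by
  obtain ⟨t, ht⟩ := hV x hx
  change TensorProduct.rid k H (LinearMap.lTensor H f (Coalgebra.comul (R := k) x)) ∈ V
  rw [← ht]
  clear ht
  induction t with
  | zero => simp
  | add x y hx hy => simp only [map_add]; exact add_mem hx hy
  | tmul x y => simpa using V.smul_mem _ x.2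

lemma PF.stable_U (V : Submodule k H) (hV : IsSubcoalgebra k V) (f : H →ₗ[k] k) (x : H)
    (hx : x ∈ V) : PF.U f x ∈ V := by
  obtain ⟨t, ht⟩ := hV x hx
  change TensorProduct.lid k H (LinearMap.rTensor H f (Coalgebra.comul (R := k) x)) ∈ V
  rw [← ht]
  clear ht
  induction t with
  | zero => simp
  | add x y hx hy => simp only [map_add]; exact add_mem hx hy
  | tmul x y => simpa using V.smul_mem _ y.2

/-- left hits are R-linear -/
noncomputable def PF.UR (f : H →ₗ[k] k) : H →ₗ[PF.R k H] H where
  toFun := PF.U f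
  map_add' := map_add _
  map_smul' := by
    intro r x
    obtain ⟨g, rfl⟩ := PF.exists_TR r
    exact PF.U_T f g x

lemma PF.hom_eq_U (S : Submodule (PF.R k H) H) (θ : S →ₗ[PF.R k H] H) :
    ∃ a : H →ₗ[k] k, ∀ x : S, θ x = PF.U a x := by
  let S' : Submodule k H := S.restrictScalars k
  let l : S' →ₗ[k] k := Coalgebra.counit (R := k) ∘ₗ (θ.restrictScalars k)
  obtain ⟨a, hA⟩ := l.exists_extend
  refine ⟨a, fun x => ?_⟩
  rw [← sub_eq_zero, ← Module.forall_dual_apply_eq_zero_iff k]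
  intro f
  rw [map_sub, sub_eq_zero, PF.apply_U]
  have h1 : a (PF.T f x) = l (PF.TR f • x) := LinearMap.congr_fun hA (PF.TR f • x)
  rw [h1]
  change _ = Coalgebra.counit (R := k) (θ (PF.TR f • x))
  rw [map_smul, PF.TR_smul, PF.counit_T]

lemma PF.simple_le (S : Submodule (PF.R k H) H) [IsSimpleModule (PF.R k H) S] (x : H) (hx : x ∈ S) :
    x ∈ coradical k H := by
  let D := isotypicComponent (PF.R k H) H S
  have hD : IsSimpleSubcoalgebra k (D.restrictScalars k) := by
    refine ⟨PF.isSub_of_stable _ ?_ ?_, ?_, ?_⟩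
    · intro f x hx
      exact D.smul_mem (PF.TR f) hx
    · intro f x hx
      exact LinearMap.le_comap_isotypicComponent (S := S) (PF.UR f) hx
    · intro h
      have := bot_lt_isotypicComponent S
      rw [Submodule.restrictScalars_eq_bot_iff] at h
      exact this.ne' h
    · intro W hW hWD
      by_cases hW0 : W = ⊥
      · exact Or.inl hW0
      right
      refine le_antisymm hWD ?_
      let W' : Submodule (PF.R k H) H :=
        { W with
          smul_mem' := by
            intro r x hx
            obtain ⟨g, rfl⟩ := PF.exists_TR r
            exact PF.stable_T W hW g x hx }
      have hW'D : W' ≤ D := hWD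
      have hW'0 : W' ≠ ⊥ := by
        intro h
        apply hW0
        rw [eq_bot_iff]
        intro x hx
        have : x ∈ W' := hx
        rw [h] at this
        exact this
      have : IsSemisimpleModule (PF.R k H) D := inferInstanceAs
        (IsSemisimpleModule (PF.R k H) (isotypicComponent (PF.R k H) H S))
      have : IsSemisimpleModule (PF.R k H) W' :=
        IsSemisimpleModule.of_injective (Submodule.inclusion hW'D) (Submodule.inclusion_injective _)
      have : Nontrivial W' := Submodule.nontrivial_iff_ne_bot.mpr hW'0
      obtain ⟨m, hm⟩ := IsSemisimpleModule.exists_simple_submodule (PF.R k H) W'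
      have iso := (IsIsotypicOfType.isotypicComponent (PF.R k H) H S).of_injective
        (Submodule.inclusion hW'D) (Submodule.inclusion_injective _)
      obtain ⟨e⟩ := iso m
      have key : D ≤ W' := by
        apply sSup_le
        rintro S2 ⟨e2⟩
        intro y hy
        let m' : Submodule (PF.R k H) H := m.map W'.subtype
        let em : m ≃ₗ[PF.R k H] m' := Submodule.equivMapOfInjective W'.subtype W'.injective_subtype m
        let E : m' ≃ₗ[PF.R k H] S2 := em.symm.trans (e.trans e2.symm)
        obtain ⟨a, hA⟩ := PF.hom_eq_U m' (S2.subtype ∘ₗ E.toLinearMap)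
        have h1 := hA (E.symm ⟨y, hy⟩)
        simp only [LinearMap.comp_apply, LinearEquiv.coe_coe, LinearEquiv.apply_symm_apply,
          Submodule.subtype_apply] at h1
        rw [h1]
        apply PF.stable_U W hW
        obtain ⟨z, hz, hz'⟩ := (E.symm ⟨y, hy⟩).2
        rw [← hz']
        exact z.2
      exact key
  exact (le_sSup hD : D.restrictScalars k ≤ coradical k H) (Submodule.le_isotypicComponent S hx)

lemma PF.embed [FiniteDimensional k H] (Q : Type) [AddCommGroup Q] [Module k Q] [Module (PF.R k H) Q]
    [IsScalarTower k (PF.R k H) Q] [Nontrivial Q] :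
    ∃ θ : Q →ₗ[PF.R k H] H, θ ≠ 0 := by
  obtain ⟨q, hq⟩ := exists_ne (0 : Q)
  obtain ⟨l, hl⟩ : ∃ l : Module.Dual k Q, l q ≠ 0 := by
    by_contra! h
    exact hq ((Module.forall_dual_apply_eq_zero_iff k q).mp h)
  let ev : Q →ₗ[k] Module.Dual k (Module.Dual k H) :=
    LinearMap.mk₂ k (fun (q : Q) (f : Module.Dual k H) => l (PF.TR f • q))
      (by intros; simp) (by intro c m n; rw [smul_comm, map_smul])
      (by
        intro m f g
        have : PF.TR (f + g) = PF.TR f + PF.TR g := PF.incl_inj (PF.T_add f g)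
        rw [this, add_smul, map_add])
      (by
        intro c m f
        have : PF.TR (c • f) = c • PF.TR f := PF.incl_inj (PF.T_smul c f)
        rw [this, smul_assoc, map_smul])
  let th : Q →ₗ[k] H := (Module.evalEquiv k H).symm.toLinearMap ∘ₗ ev
  have hth : ∀ q f, f (th q) = l (PF.TR f • q) := by
    intro q f
    have := LinearMap.congr_fun ((Module.evalEquiv k H).apply_symm_apply (ev q)) f
    exact this
  refine ⟨{ th with
    map_smul' := ?_ }, ?_⟩
  · intro r q
    obtain ⟨g, rfl⟩ := PF.exists_TR r
    change th (PF.TR g • q) = PF.T g (th q)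
    rw [← sub_eq_zero, ← Module.forall_dual_apply_eq_zero_iff k]
    intro f
    rw [map_sub, sub_eq_zero, hth]
    have h2 := hth q (f ∘ₗ PF.T g)
    have h3 : PF.TR (f ∘ₗ PF.T g) = PF.TR f * PF.TR g := PF.incl_inj (PF.T_mul f g)
    rw [h3, mul_smul] at h2
    exact h2.symm
  · intro h
    apply hl
    have h1 : th q = 0 := LinearMap.congr_fun h q
    have h2 := hth q Coalgebra.counit
    have h3 : PF.TR (Coalgebra.counit (R := k) (A := H)) = 1 := PF.incl_inj PF.T_counit
    rw [h1, h3, one_smul, map_zero] at h2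
    exact h2.symm

lemma PF.T_grouplike (f : H →ₗ[k] k) (g : H) (hg : IsGrouplike k g) : PF.T f g = f g • g := by
  simp [PF.T, hg.2]

lemma PF.mem_jac [FiniteDimensional k H] (hpt : IsPointedHopf k H) (f : H →ₗ[k] k)
    (hf : ∀ g, IsGrouplike k g → f g = 0) : PF.TR f ∈ Ring.jacobson (PF.R k H) := by
  rw [Ring.jacobson, Module.jacobson, Submodule.mem_sInf]
  intro M hM
  have : IsSimpleModule (PF.R k H) (PF.R k H ⧸ M) := isSimpleModule_iff_isCoatom.mpr hM
  have : Nontrivial (PF.R k H ⧸ M) := IsSimpleModule.nontrivial (PF.R k H) _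
  obtain ⟨θ, hθ⟩ := PF.embed (k := k) (H := H) (PF.R k H ⧸ M)
  have inj := LinearMap.injective_of_ne_zero hθ
  have : IsSimpleModule (PF.R k H) (LinearMap.range θ) :=
    IsSimpleModule.congr (LinearEquiv.ofInjective θ inj).symm
  have h1 : θ (Submodule.Quotient.mk 1) ∈ coradical k H := PF.simple_le (LinearMap.range θ) _ ⟨_, rfl⟩
  rw [hpt] at h1
  have h2 : PF.T f (θ (Submodule.Quotient.mk 1)) = 0 := by
    generalize θ (Submodule.Quotient.mk 1) = y at h1
    induction h1 using Submodule.span_induction with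
    | mem x h => rw [PF.T_grouplike f x h, hf x h, zero_smul]
    | zero => simp
    | add x y _ _ hx hy => simp [hx, hy]
    | smul c x _ hx => simp [hx]
  rw [← PF.TR_smul, ← map_smul] at h2
  have h3 := inj (h2.trans (map_zero θ).symm)
  rw [← Submodule.Quotient.mk_smul, Submodule.Quotient.mk_eq_zero, smul_eq_mul, mul_one] at h3
  exact h3

/-- The filtration. -/
lemma PF.filtration [FiniteDimensional k H] (hpt : IsPointedHopf k H) :
    ∃ (Z : ℕ → Submodule k H) (m : ℕ), Z 0 = ⊥ ∧ Z m = ⊤ ∧ ∀ j, ∀ x ∈ Z (j + 1),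
      ∀ f : H →ₗ[k] k, (∀ g, IsGrouplike k g → f g = 0) → PF.T f x ∈ Z j := by
  have : IsArtinianRing (PF.R k H) := IsArtinianRing.of_finite k _
  obtain ⟨m, hm⟩ := IsSemiprimaryRing.isNilpotent (R := PF.R k H)
  refine ⟨fun j =>
    { carrier := {x | ∀ r ∈ (Ring.jacobson (PF.R k H)) ^ j, r • x = 0}
      add_mem' := ?_
      zero_mem' := ?_
      smul_mem' := ?_ }, m, ?_, ?_, ?_⟩
  · intro a b h1 h2 r hr
    rw [smul_add, h1 r hr, h2 r hr, add_zero]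
  · intro r hr
    simp
  · intro c x hx r hr
    rw [smul_comm, hx r hr, smul_zero]
  · rw [eq_bot_iff]
    intro x hx
    have h0 : (1 : PF.R k H) ∈ (Ring.jacobson (PF.R k H)) ^ 0 := by
      simp [Submodule.pow_zero]
    have := hx 1 h0
    simpa using this
  · rw [eq_top_iff]
    intro x _ r hr
    rw [hm] at hr
    rw [show r = 0 from hr, zero_smul]
  · intro j x hx f hf r hr
    rw [← PF.TR_smul, ← mul_smul]
    apply hx
    rw [Submodule.pow_succ]
    exact Ideal.mul_mem_mul hr (PF.mem_jac hpt f hf)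

end CoalgPart

section ActPart
variable {k : Type} [Field k] {H : Type} [Ring H] [HopfAlgebra k H]
  {L : Type} [Field L] [Algebra k L] (ha : HopfAction k H L)

lemma PF.act_mul_repr (h : H) {ι : Type*} (r : Coalgebra.Repr k h ι) (a b : L) :
    ha.act h (a * b) = ∑ i ∈ r.index, ha.act (r.left i) a * ha.act (r.right i) b := by
  rw [ha.act_mul, ← r.eq]
  simp

lemma PF.act_inv_mul {a : L} (haa : a ∈ ha.invariants) (h : H) (b : L) :
    ha.act h (a * b) = a * ha.act h b := by
  let r := Coalgebra.Repr.arbitrary k h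
  rw [PF.act_mul_repr ha h r]
  have := Coalgebra.sum_counit_smul (R := k) r
  conv_rhs => rw [← this]
  rw [map_sum, LinearMap.sum_apply, Finset.mul_sum]
  refine Finset.sum_congr rfl fun i _ => ?_
  rw [haa (r.left i)]
  simp

/-- The field of invariants. -/
def PF.K : IntermediateField k L where
  carrier := ha.invariants
  mul_mem' := by
    intro a b h1 h2 h
    rw [PF.act_inv_mul ha h1, h2 h, mul_smul_comm]
  add_mem' := by
    intro a b h1 h2 h
    rw [map_add, h1 h, h2 h, smul_add]
  algebraMap_mem' := by
    intro c h
    rw [Algebra.algebraMap_eq_smul_one, map_smul, ha.act_one, smul_comm]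
  inv_mem' := by
    intro a h1 h
    by_cases h0 : a = 0
    · simp [h0]
    have := PF.act_inv_mul ha h1 h a⁻¹
    rw [mul_inv_cancel₀ h0, ha.act_one] at this
    apply mul_left_cancel₀ h0
    rw [← this, mul_smul_comm, mul_inv_cancel₀ h0]

lemma PF.mem_K {a : L} : a ∈ PF.K ha ↔ ∀ h, ha.act h a = Coalgebra.counit (R := k) h • a :=
  Iff.rfl

lemma PF.act_smul (c : PF.K ha) (h : H) (b : L) : ha.act h (c • b) = c • ha.act h b := by
  rw [IntermediateField.smul_def, IntermediateField.smul_def]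
  exact PF.act_inv_mul ha c.2 h b

/-- Auxiliary map `p ⊗ (q ⊗ s) ↦ p(a) * (q S(s)) b`. -/
noncomputable def PF.Psi (a b : L) : H ⊗[k] (H ⊗[k] H) →ₗ[k] L :=
  LinearMap.mul' k L ∘ₗ TensorProduct.map
    (LinearMap.flip (ha.act.toLinearMap : H →ₗ[k] L →ₗ[k] L) a)
    ((LinearMap.flip (ha.act.toLinearMap : H →ₗ[k] L →ₗ[k] L) b) ∘ₗ
      LinearMap.mul' k H ∘ₗ LinearMap.lTensor H (HopfAlgebra.antipode k (A := H)))

lemma PF.Psi_tmul (a b : L) (p q s : H) : PF.Psi ha a b (p ⊗ₜ (q ⊗ₜ s)) =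
    ha.act p a * ha.act q (ha.act (HopfAlgebra.antipode k s) b) := by
  simp [PF.Psi]

lemma PF.act_mul_eq (h : H) {ι : Type*} (r : Coalgebra.Repr k h ι) (a b : L) :
    ha.act h a * b = ∑ i ∈ r.index,
      ha.act (r.left i) (a * ha.act (HopfAlgebra.antipode k (r.right i)) b) := by
  have key := congrArg (PF.Psi ha a b) (Coalgebra.sum_tmul_tmul_eq r
    (fun i => Coalgebra.Repr.arbitrary k (r.left i))
    (fun i => Coalgebra.Repr.arbitrary k (r.right i)))
  simp only [map_sum, PF.Psi_tmul] at key
  have e1 : ∀ i, ha.act (r.left i) (a * ha.act (HopfAlgebra.antipode k (r.right i)) b) = _ :=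
    fun i => PF.act_mul_repr ha (r.left i) (Coalgebra.Repr.arbitrary k (r.left i)) _ _
  simp only [e1]
  rw [key]
  have : ∑ i ∈ r.index, Coalgebra.counit (R := k) (r.right i) • r.left i = h := by
    have := congrArg (TensorProduct.rid k H) (Coalgebra.sum_tmul_counit_eq (R := k) r)
    simpa only [map_sum, TensorProduct.rid_tmul, one_smul] using this
  conv_lhs => rw [← this]
  rw [map_sum, LinearMap.sum_apply, Finset.sum_mul]
  refine Finset.sum_congr rfl fun i _ => ?_
  have h2 := HopfAlgebra.sum_mul_antipode_eq_smul (R := k)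
    (Coalgebra.Repr.arbitrary k (r.right i))
  have h3 := congrArg (fun z => ha.act z b) h2
  simp only [map_sum, map_mul, LinearMap.sum_apply, Module.End.mul_apply, map_smul, map_one,
    LinearMap.smul_apply, Module.End.one_apply] at h3
  rw [← Finset.mul_sum, h3]
  simp

/-- Artin-type descent: nonzero `H`-stable subspaces contain invariant vectors. -/
lemma PF.descent {ι : Type} [Fintype ι] (W : Submodule L (ι → L))
    (hW : ∀ c ∈ W, ∀ h, (fun i => ha.act h (c i)) ∈ W) (h0 : W ≠ ⊥) :
    ∃ c ∈ W, c ≠ 0 ∧ ∀ i, c i ∈ PF.K ha := by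
  classical
  obtain ⟨w0, hw0, hne⟩ := Submodule.exists_mem_ne_zero_of_ne_bot h0
  have hex : ∃ n, ∃ w ∈ W, w ≠ 0 ∧ (Finset.univ.filter fun i => w i ≠ 0).card = n :=
    ⟨_, w0, hw0, hne, rfl⟩
  obtain ⟨w, hw, hwne, hcard⟩ := Nat.find_spec hex
  obtain ⟨i, hi⟩ := Function.ne_iff.mp hwne
  have hi : w i ≠ 0 := hi
  refine ⟨(w i)⁻¹ • w, W.smul_mem _ hw, smul_ne_zero (inv_ne_zero hi) hwne, ?_⟩
  set c := (w i)⁻¹ • w with hc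
  have hcW : c ∈ W := W.smul_mem _ hw
  have hci : c i = 1 := by simp [hc, hi]
  have hcz : ∀ j, w j = 0 → c j = 0 := by intro j hj; simp [hc, hj]
  intro j h
  let d : ι → L := (fun i => ha.act h (c i)) - algebraMap k L (Coalgebra.counit (R := k) h) • c
  have hd : d ∈ W := W.sub_mem (hW c hcW h) (W.smul_mem _ hcW)
  have hd0 : d = 0 := by
    by_contra hdne
    have hlt : (Finset.univ.filter fun i => d i ≠ 0).card < Nat.find hex := by
      rw [← hcard]
      apply Finset.card_lt_card
      rw [Finset.ssubset_iff_of_subset]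
      · refine ⟨i, by simp [hi], ?_⟩
        simp [d, hci, ha.act_one, Algebra.smul_def]
      · intro j hj
        simp only [Finset.mem_filter, Finset.mem_univ, true_and] at hj ⊢
        intro hwj
        apply hj
        simp [d, hcz j hwj]
    exact Nat.find_min hex hlt ⟨d, hd, hdne, rfl⟩
  have := congrFun hd0 j
  simp only [d, Pi.sub_apply, Pi.smul_apply, smul_eq_mul, Pi.zero_apply, sub_eq_zero] at this
  rw [this, Algebra.smul_def]

lemma PF.finite [FiniteDimensional k H] : FiniteDimensional (PF.K ha) L := by
  have hr : Module.rank (PF.K ha) L ≤ (Module.finrank k H : ℕ) := by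
    apply rank_le
    intro s hs
    by_contra hcon
    push Not at hcon
    let b := Module.finBasis k H
    let E : (s → L) →ₗ[L] (Fin (Module.finrank k H) → L) :=
      LinearMap.pi fun j => ∑ i : s, (ha.act (b j) i.1) • LinearMap.proj i
    have hE : ∀ c, E c = 0 ↔ ∀ h, ∑ i : s, c i * ha.act h i.1 = 0 := by
      intro c
      have hEj : ∀ j, E c j = ∑ i : s, c i * ha.act (b j) i.1 := by
        intro j
        simp [E, mul_comm]
      constructor
      · intro hc h
        let φ : H →ₗ[k] L := ∑ i : s, LinearMap.mulLeft k (c i) ∘ₗ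
          (LinearMap.flip (ha.act.toLinearMap : H →ₗ[k] L →ₗ[k] L) i.1)
        have hφ : ∀ h, φ h = ∑ i : s, c i * ha.act h i.1 := by
          intro h
          simp [φ]
        have : φ = 0 := b.ext fun j => by
          rw [hφ, ← hEj, hc]; rfl
        rw [← hφ, this]; rfl
      · intro hc
        ext j
        rw [hEj, hc]; rfl
    have hne : LinearMap.ker E ≠ ⊥ := by
      apply LinearMap.ker_ne_bot_of_finrank_lt
      simpa using hcon
    obtain ⟨c, hcW, hc0, hcK⟩ := PF.descent ha (LinearMap.ker E) (by
      intro c hc h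
      rw [LinearMap.mem_ker, hE] at hc ⊢
      intro h'
      let r := Coalgebra.Repr.arbitrary k h
      simp only [PF.act_mul_eq ha h r]
      rw [Finset.sum_comm]
      apply Finset.sum_eq_zero
      intro j _
      rw [← map_sum]
      have := hc (HopfAlgebra.antipode k (r.right j) * h')
      simp only [map_mul, Module.End.mul_apply] at this
      rw [this, map_zero]) hne
    rw [LinearMap.mem_ker, hE] at hcW
    have h1 := hcW 1
    simp only [map_one, Module.End.one_apply] at h1
    have := Fintype.linearIndependent_iff.mp hs (fun i => ⟨c i, hcK i⟩) (by
      rw [← h1]; rfl)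
    apply hc0
    ext i
    exact congrArg Subtype.val (this i)
  exact Module.rank_lt_aleph0_iff.mp (hr.trans_lt (Cardinal.natCast_lt_aleph0))

end ActPart

section GalPart
variable {k : Type} [Field k] {H : Type} [Ring H] [HopfAlgebra k H]
  {L : Type} [Field L] [Algebra k L] (ha : HopfAction k H L)

lemma PF.gl {g : H} : IsGrouplike k g ↔ IsGroupLikeElem k g := by
  constructor
  · rintro ⟨h0, h1⟩
    refine ⟨?_, h1⟩
    have h2 := congrArg (TensorProduct.lid k H) (Coalgebra.rTensor_counit_comul (R := k) g)
    rw [h1] at h2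
    simp only [LinearMap.rTensor_tmul, TensorProduct.lid_tmul, one_smul] at h2
    have h3 : (Coalgebra.counit (R := k) g - 1) • g = 0 := by rw [sub_smul, h2, one_smul, sub_self]
    rcases smul_eq_zero.mp h3 with h | h
    · exact sub_eq_zero.mp h
    · exact absurd h h0
  · intro h
    exact ⟨by
      rintro rfl
      have := h.counit_eq_one
      simp at this, h.comul_eq_tmul_self⟩

lemma PF.gl_mul {g : H} (hg : IsGrouplike k g) (a b : L) :
    ha.act g (a * b) = ha.act g a * ha.act g b := by
  rw [ha.act_mul, hg.2]
  simp

lemma PF.gl_inv {g : H} (hg : IsGrouplike k g) (a : L) :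
    ha.act (HopfAlgebra.antipode k g) (ha.act g a) = a := by
  rw [← Module.End.mul_apply, ← map_mul, (PF.gl.mp hg).antipode_mul_cancel]
  simp

lemma PF.gl_inv' {g : H} (hg : IsGrouplike k g) (a : L) :
    ha.act g (ha.act (HopfAlgebra.antipode k g) a) = a := by
  rw [← Module.End.mul_apply, ← map_mul, (PF.gl.mp hg).mul_antipode_cancel]
  simp

/-- The automorphism of a grouplike. -/
noncomputable def PF.aut {g : H} (hg : IsGrouplike k g) : L ≃ₐ[PF.K ha] L :=
  AlgEquiv.ofBijective
    (AlgHom.ofLinearMap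
      { toFun := fun a => ha.act g a
        map_add' := map_add _
        map_smul' := fun c b => PF.act_smul ha c g b }
      (by
        change ha.act g 1 = 1
        rw [ha.act_one, (PF.gl.mp hg).counit_eq_one, one_smul])
      (fun a b => PF.gl_mul ha hg a b))
    ⟨Function.LeftInverse.injective (PF.gl_inv ha hg),
      Function.RightInverse.surjective (PF.gl_inv' ha hg)⟩

lemma PF.aut_apply {g : H} (hg : IsGrouplike k g) (a : L) : PF.aut ha hg a = ha.act g a := rfl

/-- The subgroup of automorphisms coming from grouplikes. -/
noncomputable def PF.Gs : Subgroup (L ≃ₐ[PF.K ha] L) where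
  carrier := {σ | ∃ g : H, IsGrouplike k g ∧ ∀ r, σ r = ha.act g r}
  one_mem' := ⟨1, PF.gl.mpr IsGroupLikeElem.one, by simp⟩
  mul_mem' := by
    rintro σ τ ⟨g, hg, h1⟩ ⟨g', hg', h2⟩
    refine ⟨g * g', PF.gl.mpr ((PF.gl.mp hg).mul (PF.gl.mp hg')), fun r => ?_⟩
    rw [map_mul, AlgEquiv.mul_apply, h2, h1, Module.End.mul_apply]
  inv_mem' := by
    rintro σ ⟨g, hg, h1⟩
    refine ⟨HopfAlgebra.antipode k g, PF.gl.mpr (PF.gl.mp hg).antipode, fun r => ?_⟩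
    apply σ.injective
    rw [h1 (ha.act _ r), PF.gl_inv' ha hg]
    exact σ.apply_symm_apply r

/-- `N_a(x) = x a - ε(x) a`. -/
noncomputable def PF.N (a : L) : H →ₗ[k] L :=
  LinearMap.flip (ha.act.toLinearMap : H →ₗ[k] L →ₗ[k] L) a -
    (LinearMap.toSpanSingleton k L a) ∘ₗ Coalgebra.counit (R := k)

lemma PF.N_apply (a : L) (x : H) :
    PF.N ha a x = ha.act x a - Coalgebra.counit (R := k) x • a := by
  simp [PF.N]

/-- Leibniz defect. -/
lemma PF.leib (a b : L) (x : H)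
    (h : TensorProduct.map (PF.N ha a) (PF.N ha b) (Coalgebra.comul (R := k) x) = 0) :
    PF.N ha (a * b) x = a * PF.N ha b x + b * PF.N ha a x := by
  let r := Coalgebra.Repr.arbitrary k x
  have h2 : ∑ i ∈ r.index, Coalgebra.counit (R := k) (r.right i) • r.left i = x := by
    have := congrArg (TensorProduct.rid k H) (Coalgebra.sum_tmul_counit_eq (R := k) r)
    simpa only [map_sum, TensorProduct.rid_tmul, one_smul] using this
  have h1 := Coalgebra.sum_counit_smul (R := k) r
  have h1' := congrArg (fun y => ha.act y b) h1
  have h2' := congrArg (fun y => ha.act y a) h2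
  have h3' := congrArg (Coalgebra.counit (R := k)) h1
  simp only [map_sum, map_smul, LinearMap.sum_apply, LinearMap.smul_apply, smul_eq_mul]
    at h1' h2' h3'
  rw [← r.eq] at h
  have h' := congrArg (LinearMap.mul' k L) h
  simp only [map_sum, TensorProduct.map_tmul, LinearMap.mul'_apply, PF.N_apply, map_zero] at h'
  rw [PF.N_apply, PF.N_apply, PF.N_apply, PF.act_mul_repr ha x r]
  have h4 : ∑ i ∈ r.index, (ha.act (r.left i) a * ha.act (r.right i) b
     - b * (Coalgebra.counit (R := k) (r.right i) • ha.act (r.left i) a)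
     - a * (Coalgebra.counit (R := k) (r.left i) • ha.act (r.right i) b)
     + algebraMap k L (Coalgebra.counit (R := k) (r.left i) * Coalgebra.counit (R := k) (r.right i)) * (a * b)) = 0 := by
    rw [← h']
    refine Finset.sum_congr rfl fun i _ => ?_
    simp only [Algebra.smul_def, map_mul]
    ring
  rw [Finset.sum_add_distrib, Finset.sum_sub_distrib, Finset.sum_sub_distrib, ← Finset.mul_sum,
    ← Finset.mul_sum, ← Finset.sum_mul, ← map_sum, h1', h2', h3'] at h4
  simp only [Algebra.smul_def] at h4 ⊢
  linear_combination h4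

lemma PF.fixed_le [CharZero k] [FiniteDimensional k H] (hpt : IsPointedHopf k H) (a : L)
    (haG : a ∈ IntermediateField.fixedField (PF.Gs ha)) : a ∈ PF.K ha := by
  have := PF.finite ha
  have : CharZero (PF.K ha) := charZero_of_injective_algebraMap (algebraMap k (PF.K ha)).injective
  set F0 := IntermediateField.fixedField (PF.Gs ha) with hF0
  have hNg : ∀ b ∈ F0, ∀ g, IsGrouplike k g → PF.N ha b g = 0 := by
    intro b hb g hg
    rw [PF.N_apply, (PF.gl.mp hg).counit_eq_one, one_smul, sub_eq_zero]
    exact (IntermediateField.mem_fixedField_iff _ _).mp hb (PF.aut ha hg) ⟨g, hg, fun r => rfl⟩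
  obtain ⟨Z, m, hZ0, hZm, hZ⟩ := PF.filtration hpt
  have main : ∀ j, ∀ x ∈ Z j, ∀ b ∈ F0, PF.N ha b x = 0 := by
    intro j
    induction j with
    | zero =>
      intro x hx b _
      rw [hZ0, Submodule.mem_bot] at hx
      rw [hx, map_zero]
    | succ j ih =>
      intro x hx
      have hz : ∀ b ∈ F0, ∀ c ∈ F0, TensorProduct.map (PF.N ha b) (PF.N ha c)
          (Coalgebra.comul (R := k) x) = 0 := by
        intro b hb c hc
        apply PF.sep
        intro l
        have h1 := ih (PF.T (l ∘ₗ PF.N ha c) x) (hZ j x hx _ (by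
          intro g hg
          simp [hNg c hc g hg])) b hb
        rw [← h1]
        simp only [PF.T, LinearMap.comp_apply]
        generalize (Coalgebra.comul (R := k) x) = t
        induction t with
        | zero => simp
        | add x y hx hy => simp only [map_add, hx, hy]
        | tmul x y => simp
      let D : Derivation (PF.K ha) F0 L := Derivation.mk'
        { toFun := fun b => PF.N ha (b : L) x
          map_add' := by
            intro b c
            simp only [PF.N_apply, AddMemClass.coe_add, map_add, smul_add]
            ring
          map_smul' := by
            intro c b
            simp only [PF.N_apply, RingHom.id_apply]
            rw [show ((c • b : F0) : L) = c • (b : L) from rfl, PF.act_smul, smul_sub,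
              smul_comm c]  }
        (by
          intro b c
          exact PF.leib ha b c x (hz b b.2 c c.2))
      have := Algebra.FormallyUnramified.of_isSeparable (PF.K ha) F0
      have hD : D = 0 := by
        apply (KaehlerDifferential.linearMapEquivDerivation (PF.K ha) F0).symm.injective
        refine LinearMap.ext fun y => ?_
        have hy : y = 0 := Subsingleton.elim y 0
        rw [hy, map_zero, map_zero]
      intro b hb
      exact congrArg (fun D => D (⟨b, hb⟩ : F0)) hD
  intro h
  have := main m h (by rw [hZm]; trivial) a haG
  rwa [PF.N_apply, sub_eq_zero] at this

end GalPart

section InjPart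
variable {k : Type} [Field k] {H : Type} [Ring H] [HopfAlgebra k H]

/-- The two-sided ideal generated by `d`. -/
def PF.I (k : Type) [Field k] {H : Type} [Ring H] [HopfAlgebra k H] (d : H) : Submodule k H :=
  Submodule.span k {x | ∃ a b, x = a * d * b}

lemma PF.I_self (d : H) : d ∈ PF.I k d := Submodule.subset_span ⟨1, 1, by simp⟩

lemma PF.I_left (d a : H) {x : H} (hx : x ∈ PF.I k d) : a * x ∈ PF.I k d := by
  induction hx using Submodule.span_induction with
  | mem x h =>
    obtain ⟨b, c, rfl⟩ := h
    exact Submodule.subset_span ⟨a * b, c, by simp [mul_assoc]⟩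
  | zero => simp
  | add x y _ _ h1 h2 => rw [mul_add]; exact add_mem h1 h2
  | smul c x _ h => rw [mul_smul_comm]; exact Submodule.smul_mem _ _ h

lemma PF.I_right (d a : H) {x : H} (hx : x ∈ PF.I k d) : x * a ∈ PF.I k d := by
  induction hx using Submodule.span_induction with
  | mem x h =>
    obtain ⟨b, c, rfl⟩ := h
    exact Submodule.subset_span ⟨b, c * a, by simp [mul_assoc]⟩
  | zero => simp
  | add x y _ _ h1 h2 => rw [add_mul]; exact add_mem h1 h2
  | smul c x _ h => rw [smul_mul_assoc]; exact Submodule.smul_mem _ _ h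

/-- `I ⊗ H + H ⊗ I`. -/
abbrev PF.J (k : Type) [Field k] {H : Type} [Ring H] [HopfAlgebra k H] (d : H) :
    Submodule k (H ⊗[k] H) :=
  LinearMap.range (TensorProduct.map (PF.I k d).subtype (LinearMap.id (M := H))) ⊔
       LinearMap.range (TensorProduct.map (LinearMap.id (M := H)) (PF.I k d).subtype)

lemma PF.J_l (d : H) {x : H} (hx : x ∈ PF.I k d) (y : H) : x ⊗ₜ y ∈ PF.J k d :=
  Submodule.mem_sup_left ⟨(⟨x, hx⟩ : PF.I k d) ⊗ₜ y, by simp⟩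

lemma PF.J_r (d : H) {x : H} (hx : x ∈ PF.I k d) (y : H) : y ⊗ₜ x ∈ PF.J k d :=
  Submodule.mem_sup_right ⟨y ⊗ₜ (⟨x, hx⟩ : PF.I k d), by simp⟩

lemma PF.J_mul (d : H) (s t : H ⊗[k] H) {u : H ⊗[k] H}
    (hu : ∃ g g' : H, u = d ⊗ₜ g + g' ⊗ₜ d) : s * u * t ∈ PF.J k d := by
  obtain ⟨g, g', rfl⟩ := hu
  induction s with
  | zero => simp
  | add x y hx hy => rw [add_mul, add_mul]; exact add_mem hx hy
  | tmul x y =>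
    induction t with
    | zero => simp
    | add x y hx hy => rw [mul_add]; exact add_mem hx hy
    | tmul z w =>
      simp only [mul_add, add_mul, Algebra.TensorProduct.tmul_mul_tmul]
      exact add_mem (PF.J_l d (PF.I_right d z (PF.I_left d x (PF.I_self d))) _)
        (PF.J_r d (PF.I_right d w (PF.I_left d y (PF.I_self d))) _)

lemma PF.inj {L : Type} [Field L] [Algebra k L] (ha : HopfAction k H L)
    (hif : InnerFaithful k ha.act.toLinearMap) {g g' : H} (hg : IsGrouplike k g)
    (hg' : IsGrouplike k g') (h : ha.act g = ha.act g') : g = g' := by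
  have G := PF.gl.mp hg
  have G' := PF.gl.mp hg'
  let I : HopfIdeal k H :=
    { carrier := PF.I k (g - g')
      mul_mem_left := fun a x hx => PF.I_left _ a hx
      mul_mem_right := fun a x hx => PF.I_right _ a hx
      comul_mem := by
        intro x hx
        change _ ∈ PF.J k (g - g')
        induction hx using Submodule.span_induction with
        | mem x h =>
          obtain ⟨b, c, rfl⟩ := h
          rw [Bialgebra.comul_mul, Bialgebra.comul_mul]
          apply PF.J_mul
          refine ⟨g, g', ?_⟩
          rw [map_sub, hg.2, hg'.2, TensorProduct.sub_tmul, TensorProduct.tmul_sub]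
          abel
        | zero => simp
        | add x y _ _ h1 h2 => rw [map_add]; exact add_mem h1 h2
        | smul c x _ h => rw [map_smul]; exact Submodule.smul_mem _ _ h
      counit_eq_zero := by
        intro x hx
        induction hx using Submodule.span_induction with
        | mem x h =>
          obtain ⟨b, c, rfl⟩ := h
          rw [Bialgebra.counit_mul, Bialgebra.counit_mul, map_sub, G.counit_eq_one,
            G'.counit_eq_one]
          simp
        | zero => simp
        | add x y _ _ h1 h2 => rw [map_add, h1, h2, add_zero]
        | smul c x _ h => rw [map_smul, h, smul_zero]
      antipode_mem := by
        intro x hx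
        induction hx using Submodule.span_induction with
        | mem x h =>
          obtain ⟨b, c, rfl⟩ := h
          have e : HopfAlgebra.antipode k (g - g') =
              HopfAlgebra.antipode k g * (-(g - g')) * HopfAlgebra.antipode k g' := by
            rw [neg_sub, mul_sub, sub_mul, G.antipode_mul_cancel, mul_assoc,
              G'.mul_antipode_cancel, map_sub]
            simp
          rw [HopfAlgebra.antipode_mul_antidistrib, HopfAlgebra.antipode_mul_antidistrib, e]
          exact PF.I_left _ _ (PF.I_right _ _ (PF.I_right _ _ (PF.I_left _ _
            (neg_mem (PF.I_self _)))))
        | zero => simp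
        | add x y _ _ h1 h2 => rw [map_add]; exact add_mem h1 h2
        | smul c x _ h => rw [map_smul]; exact Submodule.smul_mem _ _ h }
  have hI : I.carrier = ⊥ := by
    apply hif
    intro x hx
    change x ∈ PF.I k (g - g') at hx
    change ha.act x = 0
    induction hx using Submodule.span_induction with
    | mem x hx =>
      obtain ⟨b, c, rfl⟩ := hx
      rw [map_mul, map_mul, map_sub, h]
      simp
    | zero => simp
    | add x y _ _ h1 h2 => rw [map_add, h1, h2, add_zero]
    | smul c x _ h => rw [map_smul, h, smul_zero]
  have : g - g' ∈ I.carrier := PF.I_self _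
  rw [hI, Submodule.mem_bot] at this
  exact sub_eq_zero.mp this

end InjPart

/-- **Statement 8.** Let `H` be a finite dimensional pointed Hopf algebra over `k` with group of
grouplikes `G = G(H)`, acting inner faithfully on a field `L ⊇ k`.  Then the invariants `L^H`
coincide with `L^G`, they form an intermediate field `F` of `k ⊆ L`, the extension `F ⊆ L` is
finite and Galois, and its Galois group is (identified with) `G`: the grouplike elements of `H`
act by `F`-algebra automorphisms of `L` and this correspondence is a bijection between `G` and
`Gal(L/F)` (in particular `G` acts faithfully on `L`). -/
theorem pointed_inner_faithful_field_action_galois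
    (k : Type) [Field k] [IsAlgClosed k] [CharZero k]
    (H : Type) [Ring H] [HopfAlgebra k H] [FiniteDimensional k H]
    (hpt : IsPointedHopf k H)
    (L : Type) [Field L] [Algebra k L]
    (ha : HopfAction k H L) (hif : InnerFaithful k ha.act.toLinearMap) :
    ∃ F : IntermediateField k L,
      (F : Set L) = ha.invariants ∧
      (F : Set L) = {a : L | ∀ g : H, IsGrouplike k g → ha.act g a = a} ∧
      FiniteDimensional F L ∧ IsGalois F L ∧
      ∃ e : {g : H // IsGrouplike k g} ≃ (L ≃ₐ[F] L),
        ∀ (g : {g : H // IsGrouplike k g}) (r : L), (e g) r = ha.act g.1 r := by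
  have hfin := PF.finite ha
  have hbot : IntermediateField.fixedField (PF.Gs ha) = ⊥ := by
    rw [eq_bot_iff]
    intro a h
    exact IntermediateField.mem_bot.mpr ⟨⟨a, PF.fixed_le ha hpt a h⟩, rfl⟩
  have htop : PF.Gs ha = ⊤ := by
    rw [← IntermediateField.fixingSubgroup_fixedField (PF.Gs ha), hbot,
      IntermediateField.fixingSubgroup_bot]
  refine ⟨PF.K ha, rfl, ?_, hfin, IsGalois.of_fixedField_eq_bot _ _ (htop ▸ hbot), ?_⟩
  · ext a
    constructor
    · intro h g hg
      rw [(PF.mem_K ha).mp h g, (PF.gl.mp hg).counit_eq_one, one_smul]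
    · intro h
      apply PF.fixed_le ha hpt
      rw [IntermediateField.mem_fixedField_iff]
      rintro σ ⟨g, hg, hσ⟩
      rw [hσ]
      exact h g hg
  · refine ⟨Equiv.ofBijective (fun g => PF.aut ha g.2) ⟨?_, ?_⟩, fun g r => rfl⟩
    · intro g g' h
      apply Subtype.ext
      apply PF.inj ha hif g.2 g'.2
      ext r
      exact congrArg (fun σ => σ r) h
    · intro σ
      obtain ⟨g, hg, hσ⟩ : σ ∈ PF.Gs ha := htop ▸ Subgroup.mem_top σ
      refine ⟨⟨g, hg⟩, ?_⟩
      ext r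
      exact (hσ r).symm
end
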